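/- Let φ ∈ Φ, let f ∈ AC^φ(ℝ^N_+) be in the domain of the operators T_w, and let {K_w}_{w>0} satisfy conditions (K_w.1) and (K_w.2). Then there exists a constant μ > 0 such that lim_{w→+∞} V^φ[μ(T_w f − f)] = 0. -/

import Mathlib

open MeasureTheory Filter Set Asymptotics
open scoped ENNReal

noncomputable section

/-- The class `Φ`: `φ : [0,∞) → [0,∞)` convex, vanishing exactly at `0`,
with `φ(u)/u → 0` as `u → 0⁺`. -/
def IsPhiFun (φ : ℝ → ℝ) : Prop :=
  ConvexOn ℝ (Set.Ici 0) φ ∧ (∀ u, 0 ≤ u → 0 ≤ φ u) ∧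
  (∀ u, 0 ≤ u → (φ u = 0 ↔ u = 0)) ∧
  Tendsto (fun u => φ u / u) (nhdsWithin 0 (Set.Ioi 0)) (nhds 0)

/-- The positive orthant `ℝ^N_+ = (0,∞)^N`. -/
def RPos (N : ℕ) : Set (Fin N → ℝ) := {x | ∀ i, 0 < x i}

/-- `⟨t⟩ := ∏ᵢ tᵢ`. -/
def prodCoord {N : ℕ} (t : Fin N → ℝ) : ℝ := ∏ i, t i

/-- Euclidean distance `|1 - t|`. -/
def distOne {N : ℕ} (t : Fin N → ℝ) : ℝ := Real.sqrt (∑ i, (1 - t i) ^ 2)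

/-- Euclidean norm `|log t|` of `log t := (log t₁, …, log t_N)`. -/
def logNorm {N : ℕ} (t : Fin N → ℝ) : ℝ := Real.sqrt (∑ i, Real.log (t i) ^ 2)

/-- `t^w := (t₁^w, …, t_N^w)`. -/
def powVec {N : ℕ} (t : Fin N → ℝ) (w : ℝ) : Fin N → ℝ := fun i => t i ^ w

/-- The (Musielak–Orlicz) `φ`-variation of `g` on `[a,b]`:
`sup_D ∑ᵢ φ(|g(sᵢ) - g(sᵢ₋₁)|)` over all partitions `D` of `[a,b]`. -/
def phiVar1 (φ : ℝ → ℝ) (a b : ℝ) (g : ℝ → ℝ) : ℝ≥0∞ :=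
  ⨆ (n : ℕ) (u : Fin (n + 1) → ℝ) (_ : Monotone u) (_ : u 0 = a) (_ : u (Fin.last n) = b),
    ∑ i : Fin n, ENNReal.ofReal (φ |g (u i.succ) - g (u i.castSucc)|)

/-- The point of `ℝ^N` obtained from `x'` (coordinates `≠ j`) by inserting `s`
at the `j`-th coordinate. -/
def insertCoord {N : ℕ} (j : Fin N) (x' : {i : Fin N // i ≠ j} → ℝ) (s : ℝ) :
    Fin N → ℝ :=
  fun i => if h : i = j then s else x' ⟨i, h⟩

/-- `Φ^φ_j(f, I)`: the integral over `I'_j` (with weight `⟨x'_j⟩⁻¹`) of the `φ`-variations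
of the `j`-th sections of `f`, where `I = ∏ᵢ [aᵢ, bᵢ]`. -/
def secVar {N : ℕ} (φ : ℝ → ℝ) (f : (Fin N → ℝ) → ℝ) (a b : Fin N → ℝ) (j : Fin N) :
    ℝ≥0∞ :=
  ∫⁻ x' in Set.pi Set.univ (fun i : {i : Fin N // i ≠ j} => Set.Icc (a i.1) (b i.1)),
    phiVar1 φ (a j) (b j) (fun s => f (insertCoord j x' s)) *
      ENNReal.ofReal ((∏ i : {i : Fin N // i ≠ j}, x' i)⁻¹)

/-- `Φ^φ(f, I) := (∑_j Φ^φ_j(f,I)²)^{1/2}`. -/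
def boxPhi {N : ℕ} (φ : ℝ → ℝ) (f : (Fin N → ℝ) → ℝ) (a b : Fin N → ℝ) : ℝ≥0∞ :=
  (∑ j : Fin N, secVar φ f a b j ^ 2) ^ ((1 : ℝ) / 2)

/-- `{J_1, …, J_m}`, with `J_k = ∏ᵢ [c k i, d k i]`, is a partition of `I = ∏ᵢ [aᵢ, bᵢ]`
into non-overlapping `N`-dimensional intervals covering `I`. -/
def IsBoxPartition {N : ℕ} (a b : Fin N → ℝ) {m : ℕ} (c d : Fin m → Fin N → ℝ) : Prop :=
  (∀ k i, c k i ≤ d k i) ∧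
  (⋃ k, Set.pi Set.univ fun i => Set.Icc (c k i) (d k i)) =
    Set.pi Set.univ (fun i => Set.Icc (a i) (b i)) ∧
  Pairwise fun k l =>
    Disjoint (Set.pi Set.univ fun i => Set.Ioo (c k i) (d k i))
      (Set.pi Set.univ fun i => Set.Ioo (c l i) (d l i))

/-- The multidimensional (Tonelli-type) `φ`-variation `V^φ_I[f]` of `f` on
`I = ∏ᵢ [aᵢ, bᵢ]`: the sup of `∑ₖ Φ^φ(f, J_k)` over all partitions of `I` into
`N`-dimensional intervals. -/
def varOn {N : ℕ} (φ : ℝ → ℝ) (f : (Fin N → ℝ) → ℝ) (a b : Fin N → ℝ) : ℝ≥0∞ :=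
  ⨆ (m : ℕ) (c : Fin m → Fin N → ℝ) (d : Fin m → Fin N → ℝ) (_ : IsBoxPartition a b c d),
    ∑ k, boxPhi φ f (c k) (d k)

/-- `V^φ[f]`, the `φ`-variation of `f` over the whole `ℝ^N_+`: the sup of `V^φ_I[f]`
over all intervals `I ⊂ ℝ^N_+`. -/
def totalVar {N : ℕ} (φ : ℝ → ℝ) (f : (Fin N → ℝ) → ℝ) : ℝ≥0∞ :=
  ⨆ (a : Fin N → ℝ) (b : Fin N → ℝ) (_ : ∀ i, 0 < a i) (_ : ∀ i, a i ≤ b i),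
    varOn φ f a b

/-- `f ∈ BV^φ(ℝ^N_+)`: `f` measurable with `V^φ[λ f] < ∞` for some `λ > 0`. -/
def MemBVphi {N : ℕ} (φ : ℝ → ℝ) (f : (Fin N → ℝ) → ℝ) : Prop :=
  Measurable f ∧ ∃ l > (0 : ℝ), totalVar φ (fun x => l * f x) < ⊤

/-- The Mellin-type operator `(T f)(s) := ∫_{ℝ^N_+} K(t) f(st) ⟨t⟩⁻¹ dt`. -/
def mellinOp {N : ℕ} (K : (Fin N → ℝ) → ℝ) (f : (Fin N → ℝ) → ℝ) (s : Fin N → ℝ) : ℝ :=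
  ∫ t in RPos N, K t * f (s * t) * (prodCoord t)⁻¹

/-- `f` belongs to the domain of the operators `T_w`: the defining integrals exist
finitely for every `s ∈ ℝ^N_+` and `w > 0`. -/
def InDomain {N : ℕ} (K : ℝ → (Fin N → ℝ) → ℝ) (f : (Fin N → ℝ) → ℝ) : Prop :=
  ∀ w > (0 : ℝ), ∀ s ∈ RPos N,
    IntegrableOn (fun t => K w t * f (s * t) * (prodCoord t)⁻¹) (RPos N)

/-- Condition `(K_w.1)` with absolute constant `A`: each `K_w` is measurable and
integrable w.r.t. `⟨t⟩⁻¹ dt`, with `∫ |K_w| dμ ≤ A` and `∫ K_w dμ = 1`. -/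
def KernelCond1 {N : ℕ} (K : ℝ → (Fin N → ℝ) → ℝ) (A : ℝ) : Prop :=
  ∀ w > (0 : ℝ), Measurable (K w) ∧
    IntegrableOn (fun t => K w t * (prodCoord t)⁻¹) (RPos N) ∧
    (∫ t in RPos N, |K w t| * (prodCoord t)⁻¹) ≤ A ∧
    (∫ t in RPos N, K w t * (prodCoord t)⁻¹) = 1

/-- Condition `(K_w.2)`: for every `δ ∈ (0,1)`,
`∫_{|1-t|>δ} |K_w(t)| ⟨t⟩⁻¹ dt → 0` as `w → +∞`. -/
def KernelCond2 {N : ℕ} (K : ℝ → (Fin N → ℝ) → ℝ) : Prop :=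
  ∀ δ : ℝ, 0 < δ → δ < 1 →
    Tendsto (fun w => ∫ t in {t ∈ RPos N | δ < distOne t}, |K w t| * (prodCoord t)⁻¹)
      atTop (nhds 0)

/-- The `φ`-modulus of smoothness `ω^φ(f, δ) := sup_{|1-t| ≤ δ} V^φ[τ_t f - f]`. -/
def modSmooth {N : ℕ} (φ : ℝ → ℝ) (f : (Fin N → ℝ) → ℝ) (δ : ℝ) : ℝ≥0∞ :=
  ⨆ (t : Fin N → ℝ) (_ : t ∈ RPos N) (_ : distOne t ≤ δ),
    totalVar φ (fun s => f (s * t) - f s)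

/-- `f` is locally `φ`-absolutely continuous on `ℝ^N_+` (uniformly, in the sense of
Tonelli) with constant `l`. -/
def LocACphiWith {N : ℕ} (φ : ℝ → ℝ) (f : (Fin N → ℝ) → ℝ) (l : ℝ) : Prop :=
  ∀ a b : Fin N → ℝ, (∀ i, 0 < a i) → (∀ i, a i ≤ b i) → ∀ j : Fin N,
    ∀ ε > (0 : ℝ), ∃ δ > (0 : ℝ),
      ∀ᵐ x' ∂(volume.restrict
          (Set.pi Set.univ (fun i : {i : Fin N // i ≠ j} => Set.Icc (a i.1) (b i.1)))),
        ∀ n : ℕ, ∀ α β : Fin n → ℝ,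
          (∀ i, a j ≤ α i ∧ α i ≤ β i ∧ β i ≤ b j) →
          (Pairwise fun i i' =>
            Disjoint (Set.Ioo (α i) (β i)) (Set.Ioo (α i') (β i'))) →
          (∑ i, φ (β i - α i)) < δ →
          (∑ i, φ (l * |f (insertCoord j x' (β i)) - f (insertCoord j x' (α i))|)) < ε

/-- `f ∈ AC^φ(ℝ^N_+)`: `f` is measurable, of bounded `φ`-variation and locally
`φ`-absolutely continuous on `ℝ^N_+`. -/
def MemACphi {N : ℕ} (φ : ℝ → ℝ) (f : (Fin N → ℝ) → ℝ) : Prop :=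
  MemBVphi φ f ∧ ∃ l > (0 : ℝ), LocACphiWith φ f l

/-- `{K_w}` is an `α`-singular kernel: for every `δ ∈ (0,1)`,
`∫_{|1-t|>δ} |K_w(t)| ⟨t⟩⁻¹ dt = O(w^{-α})` as `w → +∞`. -/
def AlphaSingular {N : ℕ} (K : ℝ → (Fin N → ℝ) → ℝ) (α : ℝ) : Prop :=
  ∀ δ : ℝ, 0 < δ → δ < 1 →
    (fun w => ∫ t in {t ∈ RPos N | δ < distOne t}, |K w t| * (prodCoord t)⁻¹)
      =O[atTop] fun w : ℝ => w ^ (-α)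

/-- The Lipschitz class `V^φ Lip_N(α)`: `f ∈ BV^φ(ℝ^N_+)` such that, for some `μ > 0`,
`V^φ[μ(τ_t f - f)] = O(|log t|^α)` as `|1 - t| → 0`. -/
def MemLipAlpha {N : ℕ} (φ : ℝ → ℝ) (α : ℝ) (f : (Fin N → ℝ) → ℝ) : Prop :=
  MemBVphi φ f ∧ ∃ μ > (0 : ℝ), ∃ C > (0 : ℝ), ∃ η > (0 : ℝ),
    ∀ t ∈ RPos N, distOne t ≤ η →
      totalVar φ (fun x => μ * (f (x * t) - f x)) ≤ ENNReal.ofReal (C * logNorm t ^ α)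

namespace IsPhiFun

variable {φ : ℝ → ℝ}

lemma map_zero (h : IsPhiFun φ) : φ 0 = 0 := (h.2.2.1 0 le_rfl).2 rfl

lemma nonneg (h : IsPhiFun φ) {u : ℝ} (hu : 0 ≤ u) : 0 ≤ φ u := h.2.1 u hu

lemma map_mul_le (h : IsPhiFun φ) {c u : ℝ} (hc : 0 ≤ c) (hc1 : c ≤ 1) (hu : 0 ≤ u) :
    φ (c * u) ≤ c * φ u := by
  have := h.1.2 (x := u) (y := 0) hu self_mem_Ici hc (sub_nonneg.2 hc1) (by ring)
  simpa [h.map_zero] using this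

lemma monotoneOn (h : IsPhiFun φ) : MonotoneOn φ (Ici 0) := by
  intro u hu v hv huv
  rcases eq_or_lt_of_le (show (0 : ℝ) ≤ v from hv) with h0 | h0
  · have hu' : (0 : ℝ) ≤ u := hu
    have : u = v := le_antisymm huv (h0 ▸ hu')
    rw [this]
  · have h1 := h.map_mul_le (c := u / v) (div_nonneg hu hv) ((div_le_one h0).2 huv) hv
    rw [div_mul_cancel₀ _ h0.ne'] at h1
    refine h1.trans (mul_le_of_le_one_left (h.nonneg hv) ((div_le_one h0).2 huv))

lemma map_abs_le (h : IsPhiFun φ) {x y : ℝ} (hxy : |x| ≤ |y|) : φ |x| ≤ φ |y| :=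
  h.monotoneOn (mem_Ici.2 (abs_nonneg _)) (mem_Ici.2 (abs_nonneg _)) hxy

lemma exists_le_mul (h : IsPhiFun φ) {ε : ℝ} (hε : 0 < ε) :
    ∃ η > 0, ∀ u, 0 ≤ u → u < η → φ u ≤ ε * u := by
  have := h.2.2.2.eventually (gt_mem_nhds hε)
  obtain ⟨η, hη, H⟩ := mem_nhdsGT_iff_exists_Ioo_subset.1 this
  refine ⟨η, hη, fun u hu huη => ?_⟩
  rcases hu.eq_or_lt with rfl | hu0
  · simp [h.map_zero]
  · have : φ u / u < ε := H ⟨hu0, huη⟩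
    exact ((div_lt_iff₀ hu0).1 this).le

lemma continuousOn (h : IsPhiFun φ) : ContinuousOn φ (Ici 0) := by
  intro x hx
  rcases eq_or_lt_of_le (show (0 : ℝ) ≤ x from hx) with rfl | hx0
  · obtain ⟨η, hη, H⟩ := h.exists_le_mul one_pos
    rw [ContinuousWithinAt, h.map_zero]
    refine tendsto_of_tendsto_of_tendsto_of_le_of_le' tendsto_const_nhds
      (tendsto_nhdsWithin_of_tendsto_nhds tendsto_id) ?_ ?_
    · exact eventually_mem_nhdsWithin.mono fun u hu => h.nonneg hu
    · filter_upwards [eventually_mem_nhdsWithin,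
        mem_nhdsWithin_of_mem_nhds (gt_mem_nhds hη)] with u hu hu2
      simpa using H u hu hu2
  · have := (h.1.subset Ioi_subset_Ici_self (convex_Ioi 0)).continuousOn isOpen_Ioi
    exact (this.continuousAt (Ioi_mem_nhds hx0)).continuousWithinAt

lemma continuous_abs (h : IsPhiFun φ) : Continuous fun x => φ |x| :=
  h.continuousOn.comp_continuous _root_.continuous_abs fun x => abs_nonneg x

lemma tendsto_zero_of_map_abs (h : IsPhiFun φ) {ι : Type*} {l : Filter ι} {v : ι → ℝ}
    (hv : Tendsto (fun i => φ |v i|) l (nhds 0)) : Tendsto v l (nhds 0) := by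
  rw [Metric.tendsto_nhds]
  intro r hr
  have hr' : 0 < φ r := lt_of_le_of_ne (h.nonneg hr.le)
    fun h0 => hr.ne' ((h.2.2.1 r hr.le).1 h0.symm)
  filter_upwards [hv.eventually (gt_mem_nhds hr')] with i hi
  rw [Real.dist_eq, sub_zero]
  by_contra! hc
  exact absurd (h.monotoneOn hr.le (mem_Ici.2 (abs_nonneg _)) hc) (not_le.2 hi)

/-- A convex `φ` turns increments of `g` into increments of `sign g * φ |g|`. -/
lemma map_abs_half_sub_le (h : IsPhiFun φ) (x y : ℝ) :
    φ |(x - y) / 2| ≤ |SignType.sign x * φ |x| - SignType.sign y * (φ |y|)| := by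
  have key : ∀ x y : ℝ, 0 ≤ y → y ≤ x → φ ((x - y) / 2) ≤ φ x - φ y := by
    intro x y hy hyx
    rcases (hy.trans hyx).eq_or_lt with h0 | h0
    · have : y = 0 := by linarith
      simp [← h0, this, h.map_zero]
    · have h1 := h.map_mul_le (c := (x - y) / x) (div_nonneg (by linarith) h0.le)
        ((div_le_one h0).2 (by linarith)) h0.le
      have h2 := h.map_mul_le (c := y / x) (div_nonneg hy h0.le)
        ((div_le_one h0).2 hyx) h0.le
      rw [div_mul_cancel₀ _ h0.ne'] at h1 h2
      have h3 : φ ((x - y) / 2) ≤ φ (x - y) :=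
        h.monotoneOn (show (0 : ℝ) ≤ _ by linarith) (show (0 : ℝ) ≤ _ by linarith) (by linarith)
      have h4 : (x - y) / x * φ x + y / x * φ x = φ x := by field_simp; ring
      linarith
  have hp : ∀ x : ℝ, 0 ≤ x → (SignType.sign x : ℝ) * φ |x| = φ x := by
    intro x hx
    rcases hx.eq_or_lt with rfl | hx
    · simp [h.map_zero]
    · simp [hx, abs_of_pos hx]
  have hn : ∀ x : ℝ, x ≤ 0 → (SignType.sign x : ℝ) * φ |x| = - φ (-x) := by
    intro x hx
    rcases hx.eq_or_lt with rfl | hx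
    · simp [h.map_zero]
    · simp [hx, abs_of_neg hx]
  have mixed : ∀ x y : ℝ, 0 ≤ x → 0 ≤ y → φ ((x + y) / 2) ≤ φ x + φ y := by
    intro x y hx hy
    rcases le_total x y with hxy | hxy
    · have := h.monotoneOn (show (0 : ℝ) ≤ (x + y) / 2 by linarith) hy (by linarith)
      linarith [h.nonneg hx]
    · have := h.monotoneOn (show (0 : ℝ) ≤ (x + y) / 2 by linarith) hx (by linarith)
      linarith [h.nonneg hy]
  rcases le_total 0 x with hx | hx <;> rcases le_total 0 y with hy | hy
  · rw [hp x hx, hp y hy]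
    rcases le_total y x with hxy | hxy
    · rw [abs_of_nonneg (show 0 ≤ (x - y) / 2 by linarith)]
      exact (key x y hy hxy).trans (le_abs_self _)
    · rw [abs_of_nonpos (show (x - y) / 2 ≤ 0 by linarith), abs_sub_comm]
      refine le_trans ?_ ((key y x hx hxy).trans (le_abs_self _))
      exact le_of_eq (by ring_nf)
  · rw [hp x hx, hn y hy, abs_of_nonneg (show 0 ≤ (x - y) / 2 by linarith)]
    refine le_trans ?_ ((mixed x (-y) hx (by linarith)).trans ?_)
    · exact le_of_eq (by ring_nf)
    · exact (le_of_eq (by ring)).trans (le_abs_self _)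
  · rw [hn x hx, hp y hy, abs_of_nonpos (show (x - y) / 2 ≤ 0 by linarith), abs_sub_comm]
    refine le_trans ?_ ((mixed (-x) y (by linarith) hy).trans ?_)
    · exact le_of_eq (by ring_nf)
    · exact (le_of_eq (by ring)).trans (le_abs_self _)
  · rw [hn x hx, hn y hy]
    rcases le_total y x with hxy | hxy
    · rw [abs_of_nonneg (show 0 ≤ (x - y) / 2 by linarith)]
      refine le_trans ?_ ((key (-y) (-x) (by linarith) (by linarith)).trans ?_)
      · exact le_of_eq (by ring_nf)
      · exact (le_of_eq (by ring)).trans (le_abs_self _)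
    · rw [abs_of_nonpos (show (x - y) / 2 ≤ 0 by linarith), abs_sub_comm]
      refine le_trans ?_ ((key (-x) (-y) (by linarith) (by linarith)).trans ?_)
      · exact le_of_eq (by ring_nf)
      · exact (le_of_eq (by ring)).trans (le_abs_self _)

lemma ofReal_map_add_le (h : IsPhiFun φ) (x y : ℝ) :
    ENNReal.ofReal (φ |x + y|) ≤
      ENNReal.ofReal (φ |2 * x|) + ENNReal.ofReal (φ |2 * y|) := by
  rcases le_total |x| |y| with hxy | hxy
  · refine le_trans (ENNReal.ofReal_le_ofReal (h.map_abs_le ?_)) le_add_self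
    rw [abs_mul, abs_two]; linarith [abs_add_le x y]
  · refine le_trans (ENNReal.ofReal_le_ofReal (h.map_abs_le ?_)) le_self_add
    rw [abs_mul, abs_two]; linarith [abs_add_le x y]

lemma ofReal_map_add_three_le (h : IsPhiFun φ) (x y z : ℝ) :
    ENNReal.ofReal (φ |x + y + z|) ≤ ENNReal.ofReal (φ |3 * x|) +
      ENNReal.ofReal (φ |3 * y|) + ENNReal.ofReal (φ |3 * z|) := by
  have h3 : ∀ t : ℝ, |3 * t| = 3 * |t| := fun t => by simp [abs_mul]
  have hs : |x + y + z| ≤ |x| + |y| + |z| := abs_add_three x y z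
  rcases le_total |x| |y| with hxy | hxy <;> rcases le_total |y| |z| with hyz | hyz <;>
    rcases le_total |x| |z| with hxz | hxz <;>
  first
  | exact le_trans (ENNReal.ofReal_le_ofReal (h.map_abs_le (by rw [h3]; linarith)))
      (le_add_self : ENNReal.ofReal (φ |3 * z|) ≤ _)
  | exact le_trans (ENNReal.ofReal_le_ofReal (h.map_abs_le (by rw [h3]; linarith)))
      ((le_add_self : ENNReal.ofReal (φ |3 * y|) ≤ _).trans le_self_add)
  | exact le_trans (ENNReal.ofReal_le_ofReal (h.map_abs_le (by rw [h3]; linarith)))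
      ((le_self_add : ENNReal.ofReal (φ |3 * x|) ≤ _).trans le_self_add)

end IsPhiFun

/-- The `φ`-variation of `g` computed on the finite families of non-overlapping intervals
`[α, β]` that satisfy `C α β`. -/
def intervalVar (φ : ℝ → ℝ) (C : ℝ → ℝ → Prop) (g : ℝ → ℝ) : ℝ≥0∞ :=
  ⨆ (n : ℕ) (α : Fin n → ℝ) (β : Fin n → ℝ) (_ : ∀ i, α i ≤ β i ∧ C (α i) (β i))
    (_ : Pairwise fun i k => β i ≤ α k ∨ β k ≤ α i),
    ∑ i, ENNReal.ofReal (φ |g (β i) - g (α i)|)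

lemma intervalVar_le {φ : ℝ → ℝ} {C : ℝ → ℝ → Prop} {g : ℝ → ℝ} {B : ℝ≥0∞}
    (h : ∀ (n : ℕ) (α β : Fin n → ℝ), (∀ i, α i ≤ β i ∧ C (α i) (β i)) →
      (Pairwise fun i k => β i ≤ α k ∨ β k ≤ α i) →
      ∑ i, ENNReal.ofReal (φ |g (β i) - g (α i)|) ≤ B) :
    intervalVar φ C g ≤ B :=
  iSup_le fun n => iSup_le fun α => iSup_le fun β => iSup_le fun h1 => iSup_le fun h2 =>
    h n α β h1 h2

lemma le_intervalVar (φ : ℝ → ℝ) {C : ℝ → ℝ → Prop} (g : ℝ → ℝ) {n : ℕ} {α β : Fin n → ℝ}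
    (h1 : ∀ i, α i ≤ β i ∧ C (α i) (β i)) (h2 : Pairwise fun i k => β i ≤ α k ∨ β k ≤ α i) :
    ∑ i, ENNReal.ofReal (φ |g (β i) - g (α i)|) ≤ intervalVar φ C g :=
  le_iSup_of_le n <| le_iSup_of_le α <| le_iSup_of_le β <| le_iSup_of_le h1 <|
    le_iSup_of_le h2 le_rfl

lemma sum_le_intervalVar (φ : ℝ → ℝ) {C : ℝ → ℝ → Prop} (g : ℝ → ℝ) {ι : Type*} (s : Finset ι)
    {α β : ι → ℝ} (h1 : ∀ i ∈ s, α i ≤ β i ∧ C (α i) (β i))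
    (h2 : (s : Set ι).Pairwise fun i k => β i ≤ α k ∨ β k ≤ α i) :
    ∑ i ∈ s, ENNReal.ofReal (φ |g (β i) - g (α i)|) ≤ intervalVar φ C g := by
  have e := s.equivFin.symm
  have := le_intervalVar φ (C := C) g (α := fun i => α (e i)) (β := fun i => β (e i))
    (fun i => h1 _ (e i).2)
    (fun i k hik => h2 (e i).2 (e k).2 fun h => hik (e.injective (Subtype.ext h)))
  refine le_trans (le_of_eq ?_) this
  rw [← Finset.sum_coe_sort]
  exact (e.sum_comp fun i : s => ENNReal.ofReal (φ |g (β i) - g (α i)|)).symm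

lemma intervalVar_mono_of_map {φ : ℝ → ℝ} {C C' : ℝ → ℝ → Prop} {g g' : ℝ → ℝ} {e : ℝ → ℝ}
    (he : Monotone e) (hC : ∀ α β, α ≤ β → C α β → C' (e α) (e β))
    (hg : ∀ α β, φ |g β - g α| ≤ φ |g' (e β) - g' (e α)|) :
    intervalVar φ C g ≤ intervalVar φ C' g' := by
  refine intervalVar_le fun n α β h1 h2 => ?_
  refine le_trans (Finset.sum_le_sum fun i _ => ENNReal.ofReal_le_ofReal (hg (α i) (β i)))
    (le_intervalVar φ g' (α := fun i => e (α i)) (β := fun i => e (β i))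
      (fun i => ⟨he (h1 i).1, hC _ _ (h1 i).1 (h1 i).2⟩) fun i k hik => ?_)
  exact (h2 hik).imp (fun h => he h) (fun h => he h)

lemma intervalVar_mono {φ : ℝ → ℝ} {C C' : ℝ → ℝ → Prop} (g : ℝ → ℝ)
    (hC : ∀ α β, α ≤ β → C α β → C' α β) :
    intervalVar φ C g ≤ intervalVar φ C' g :=
  intervalVar_mono_of_map monotone_id hC fun _ _ => le_rfl

lemma exists_seq_tendsto_intervalVar (φ : ℝ → ℝ) (C : ℝ → ℝ → Prop) (g : ℝ → ℝ) :
    ∃ v : ℕ → ℝ≥0∞, Tendsto v atTop (nhds (intervalVar φ C g)) ∧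
      ∀ m, ∃ (n : ℕ) (α β : Fin n → ℝ), (∀ i, α i ≤ β i ∧ C (α i) (β i)) ∧
        (Pairwise fun i k => β i ≤ α k ∨ β k ≤ α i) ∧
        v m = ∑ i, ENNReal.ofReal (φ |g (β i) - g (α i)|) := by
  set S : Set ℝ≥0∞ := {r | ∃ (n : ℕ) (α β : Fin n → ℝ), (∀ i, α i ≤ β i ∧ C (α i) (β i)) ∧
        (Pairwise fun i k => β i ≤ α k ∨ β k ≤ α i) ∧
        r = ∑ i, ENNReal.ofReal (φ |g (β i) - g (α i)|)} with hS
  have hne : S.Nonempty := ⟨0, 0, Fin.elim0, Fin.elim0, fun i => i.elim0, fun i => i.elim0, by simp⟩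
  have hsup : sSup S = intervalVar φ C g := by
    apply le_antisymm
    · refine sSup_le ?_
      rintro _ ⟨n, α, β, h1, h2, rfl⟩
      exact le_intervalVar φ g h1 h2
    · exact intervalVar_le fun n α β h1 h2 => le_sSup ⟨n, α, β, h1, h2, rfl⟩
  obtain ⟨v, -, hv, hv'⟩ := exists_seq_tendsto_sSup hne (OrderTop.bddAbove S)
  exact ⟨v, hsup ▸ hv, hv'⟩

/-- Superadditivity of the variation with respect to mutually non-overlapping classes of
intervals. -/
lemma sum_intervalVar_le (φ : ℝ → ℝ) {κ : Type*} (s : Finset κ) {C : κ → ℝ → ℝ → Prop}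
    {C₀ : ℝ → ℝ → Prop} (g : ℝ → ℝ) (hC : ∀ k ∈ s, ∀ α β, α ≤ β → C k α β → C₀ α β)
    (hsep : ∀ k ∈ s, ∀ l ∈ s, k ≠ l → ∀ α β α' β', α ≤ β → α' ≤ β' → C k α β → C l α' β' →
      β ≤ α' ∨ β' ≤ α) :
    ∑ k ∈ s, intervalVar φ (C k) g ≤ intervalVar φ C₀ g := by
  choose v hv n α β h1 h2 h3 using fun k => exists_seq_tendsto_intervalVar φ (C k) g
  refine le_of_tendsto' (tendsto_finsetSum s fun k _ => hv k) fun m => ?_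
  simp_rw [h3]
  rw [Finset.sum_sigma']
  refine sum_le_intervalVar φ g (s.sigma fun k => (Finset.univ : Finset (Fin (n k m))))
    (α := fun x => α x.1 m x.2) (β := fun x => β x.1 m x.2) ?_ ?_
  · rintro ⟨k, i⟩ hk
    simp only [Finset.mem_sigma, Finset.mem_univ, and_true] at hk
    exact ⟨(h1 k m i).1, hC k hk _ _ (h1 k m i).1 (h1 k m i).2⟩
  · rintro ⟨k, i⟩ hk ⟨l, j⟩ hl hne
    simp only [Finset.mem_coe, Finset.mem_sigma, Finset.mem_univ, and_true] at hk hl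
    by_cases hkl : k = l
    · subst hkl
      exact h2 k m fun h => hne (congrArg (Sigma.mk k) h)
    · exact hsep k hk l hl hkl _ _ _ _ (h1 k m i).1 (h1 l m j).1 (h1 k m i).2 (h1 l m j).2

lemma phiVar1_le_intervalVar (φ : ℝ → ℝ) (a b : ℝ) (g : ℝ → ℝ) :
    phiVar1 φ a b g ≤ intervalVar φ (fun α β => a ≤ α ∧ β ≤ b) g := by
  refine iSup_le fun n => iSup_le fun u => iSup_le fun hu => iSup_le fun h0 => iSup_le fun hl => ?_
  refine le_intervalVar φ g (α := fun i : Fin n => u i.castSucc) (β := fun i => u i.succ)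
    (fun i => ⟨hu (Fin.castSucc_le_succ i), h0 ▸ hu (Fin.zero_le _), hl ▸ hu (Fin.le_last _)⟩) ?_
  intro i k hik
  rcases lt_or_gt_of_ne hik with h | h
  · exact Or.inl (hu (Fin.succ_le_castSucc_iff.2 h))
  · exact Or.inr (hu (Fin.succ_le_castSucc_iff.2 h))

/-- A finite family of non-overlapping subintervals of `[a, b]` can be completed to a partition of
`[a, b]`. -/
lemma exists_partition_sum_le (W : ℝ → ℝ → ℝ≥0∞) (a : ℝ) {ι : Type*} (s : Finset ι)
    (α β : ι → ℝ) (hαβ : ∀ i ∈ s, a ≤ α i ∧ α i ≤ β i)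
    (hno : (s : Set ι).Pairwise fun i k => β i ≤ α k ∨ β k ≤ α i) :
    ∀ b, a ≤ b → (∀ i ∈ s, β i ≤ b) → ∃ (n : ℕ) (u : ℕ → ℝ), Monotone u ∧ u 0 = a ∧ u n = b ∧
      (∀ i, n ≤ i → u i = b) ∧
      ∑ i ∈ s, W (α i) (β i) ≤ ∑ i ∈ Finset.range n, W (u i) (u (i + 1)) := by
  classical
  induction hm : s.card using Nat.strong_induction_on generalizing s with
  | _ m ih =>
  intro b hab hb
  rcases s.eq_empty_or_nonempty with rfl | hs
  · refine ⟨1, fun i => if i = 0 then a else b, ?_, by simp, by simp, ?_, by simp⟩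
    · intro i k hik
      by_cases hi : i = 0
      · by_cases hk : k = 0 <;> simp [hi, hk, hab]
      · have hk : k ≠ 0 := by omega
        simp [hi, hk]
    · intro i hi
      have : i ≠ 0 := by omega
      simp [this]
  · obtain ⟨i₀, hi₀, hmax⟩ := s.exists_max_image (fun i => α i + β i) hs
    have hleft : ∀ k ∈ s.erase i₀, β k ≤ α i₀ := by
      intro k hk
      obtain ⟨hk1, hk2⟩ := Finset.mem_erase.1 hk
      rcases hno hk2 hi₀ hk1 with h | h
      · exact h
      · have := hmax k hk2
        have := (hαβ k hk2).2
        have := (hαβ i₀ hi₀).2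
        linarith
    obtain ⟨n, u, hu, hu0, hun, hun', hsum⟩ := ih (s.erase i₀).card
      (by rw [← hm]; exact Finset.card_erase_lt_of_mem hi₀) (s.erase i₀)
      (fun i hi => hαβ i (Finset.mem_of_mem_erase hi))
      (hno.mono (by simp)) rfl (α i₀) (hαβ i₀ hi₀).1 hleft
    have hαi := (hαβ i₀ hi₀).2
    have hβb := hb i₀ hi₀
    have hub : ∀ i, u i ≤ α i₀ := fun i => by
      rcases le_total i n with h | h
      · exact hun ▸ hu h
      · exact (hun' i h).le
    refine ⟨n + 2, fun i => if i ≤ n then u i else if i = n + 1 then β i₀ else b, ?_, by simp [hu0],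
      by simp, ?_, ?_⟩
    · refine monotone_nat_of_le_succ fun i => ?_
      rcases lt_trichotomy i n with h | rfl | h
      · simp [h.le, Nat.succ_le_of_lt h, hu (Nat.le_succ i)]
      · simp [hun, hαi]
      · by_cases h' : i = n + 1
        · simp [h', hβb]
        · simp [h', not_le.2 h, show ¬ i + 1 ≤ n by omega, show i ≠ n by omega]
    · intro i hi
      simp [show ¬ i ≤ n by omega, show i ≠ n + 1 by omega]
    · rw [← Finset.add_sum_erase s _ hi₀, Finset.sum_range_succ, Finset.sum_range_succ, add_comm]
      refine le_trans ?_ le_self_add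
      simp only [le_refl, if_true, hun, Nat.not_succ_le_self, if_false]
      gcongr
      refine hsum.trans (le_of_eq (Finset.sum_congr rfl fun i hi => ?_))
      have := Finset.mem_range.1 hi
      simp [this.le, Nat.succ_le_of_lt this]

lemma intervalVar_le_phiVar1 (φ : ℝ → ℝ) {a b : ℝ} (hab : a ≤ b) (g : ℝ → ℝ) :
    intervalVar φ (fun α β => a ≤ α ∧ β ≤ b) g ≤ phiVar1 φ a b g := by
  refine intervalVar_le fun n α β h1 h2 => ?_
  obtain ⟨m, u, hu, hu0, hum, -, hsum⟩ := exists_partition_sum_le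
    (fun x y => ENNReal.ofReal (φ |g y - g x|)) a Finset.univ α β
    (fun i _ => ⟨(h1 i).2.1, (h1 i).1⟩) (fun i _ k _ hik => h2 hik) b hab (fun i _ => (h1 i).2.2)
  refine hsum.trans ?_
  refine le_iSup_of_le m <| le_iSup_of_le (fun i => u i) <|
    le_iSup_of_le (fun i k hik => hu hik) <| le_iSup_of_le (by simpa using hu0) <|
    le_iSup_of_le (by simpa using hum) ?_
  rw [Finset.sum_range]
  simp

lemma sum_sub_le_of_nonoverlap {a b : ℝ} (hab : a ≤ b) {n : ℕ} {α β : Fin n → ℝ}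
    (h1 : ∀ i, a ≤ α i ∧ α i ≤ β i ∧ β i ≤ b)
    (h2 : Pairwise fun i k => β i ≤ α k ∨ β k ≤ α i) : ∑ i, (β i - α i) ≤ b - a := by
  obtain ⟨m, u, hu, hu0, hum, -, hsum⟩ := exists_partition_sum_le
    (fun x y => ENNReal.ofReal (y - x)) a Finset.univ α β
    (fun i _ => ⟨(h1 i).1, (h1 i).2.1⟩) (fun i _ k _ hik => h2 hik) b hab (fun i _ => (h1 i).2.2)
  rw [← ENNReal.ofReal_sum_of_nonneg fun i _ => sub_nonneg.2 (h1 i).2.1,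
    ← ENNReal.ofReal_sum_of_nonneg fun i _ => sub_nonneg.2 (hu (Nat.le_succ i)),
    Finset.sum_range_sub, hu0, hum] at hsum
  exact (ENNReal.ofReal_le_ofReal_iff (sub_nonneg.2 hab)).1 hsum

/-- The variant of `intervalVar` using only intervals with rational endpoints. -/
def intervalVarRat (φ : ℝ → ℝ) (C : ℝ → ℝ → Prop) (g : ℝ → ℝ) : ℝ≥0∞ :=
  ⨆ (n : ℕ) (α : Fin n → ℚ) (β : Fin n → ℚ) (_ : ∀ i, α i ≤ β i ∧ C (α i) (β i))
    (_ : Pairwise fun i k => β i ≤ α k ∨ β k ≤ α i),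
    ∑ i, ENNReal.ofReal (φ |g (β i) - g (α i)|)

lemma tendsto_floor_mul_div (x : ℝ) :
    Tendsto (fun N : ℕ => ((⌊x * ((N : ℝ) + 1)⌋ / ((N : ℚ) + 1) : ℚ) : ℝ)) atTop (nhds x) := by
  have h0 : Tendsto (fun N : ℕ => x - 1 / ((N : ℝ) + 1)) atTop (nhds x) := by
    simpa using tendsto_const_nhds.sub (tendsto_one_div_add_atTop_nhds_zero_nat (𝕜 := ℝ))
  refine tendsto_of_tendsto_of_tendsto_of_le_of_le h0 tendsto_const_nhds ?_ ?_
  · intro N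
    have hN : (0 : ℝ) < N + 1 := by positivity
    push_cast
    rw [le_div_iff₀ hN, sub_mul, one_div, inv_mul_cancel₀ hN.ne']
    exact (Int.sub_one_lt_floor _).le
  · intro N
    have hN : (0 : ℝ) < N + 1 := by positivity
    push_cast
    rw [div_le_iff₀ hN]
    exact Int.floor_le _

lemma intervalVar_eq_intervalVarRat {φ : ℝ → ℝ} (hφ : IsPhiFun φ) {C : ℝ → ℝ → Prop}
    (hC : IsOpen {p : ℝ × ℝ | C p.1 p.2}) {g : ℝ → ℝ} (hg : Continuous g) :
    intervalVar φ C g = intervalVarRat φ C g := by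
  apply le_antisymm
  · refine intervalVar_le fun n α β h1 h2 => ?_
    set r : ℕ → ℝ → ℚ := fun N x => ⌊x * ((N : ℝ) + 1)⌋ / ((N : ℚ) + 1) with hr
    have hrm : ∀ N, Monotone (r N) := by
      intro N x y hxy
      have : (0 : ℝ) ≤ N + 1 := by positivity
      simp only [hr]
      gcongr
    have hrt : ∀ x, Tendsto (fun N => ((r N x : ℚ) : ℝ)) atTop (nhds x) := tendsto_floor_mul_div
    have hev : ∀ᶠ N in atTop, ∀ i, C (r N (α i)) (r N (β i)) := by
      refine eventually_all.2 fun i => ?_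
      exact ((hrt (α i)).prodMk_nhds (hrt (β i))).eventually (hC.mem_nhds (h1 i).2)
    have hlim : Tendsto (fun N => ∑ i, ENNReal.ofReal (φ |g (r N (β i)) - g (r N (α i))|)) atTop
        (nhds (∑ i, ENNReal.ofReal (φ |g (β i) - g (α i)|))) := by
      refine tendsto_finsetSum _ fun i _ => ?_
      refine ENNReal.tendsto_ofReal ((hφ.continuous_abs.tendsto _).comp ?_)
      exact ((hg.tendsto _).comp (hrt _)).sub ((hg.tendsto _).comp (hrt _))
    refine le_of_tendsto hlim (hev.mono fun N hN => ?_)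
    exact le_iSup_of_le n <| le_iSup_of_le (fun i => r N (α i)) <|
      le_iSup_of_le (fun i => r N (β i)) <| le_iSup_of_le (fun i => ⟨hrm N (h1 i).1, hN i⟩) <|
      le_iSup_of_le (fun i k hik => (h2 hik).imp (fun h => hrm N h) (fun h => hrm N h)) le_rfl
  · refine iSup_le fun n => iSup_le fun α => iSup_le fun β => iSup_le fun h1 => iSup_le fun h2 => ?_
    exact le_intervalVar φ g (α := fun i => (α i : ℝ)) (β := fun i => (β i : ℝ))
      (fun i => ⟨by exact_mod_cast (h1 i).1, (h1 i).2⟩)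
      (fun i k hik => by exact_mod_cast h2 hik)

lemma measurable_intervalVarRat {φ : ℝ → ℝ} (hφ : IsPhiFun φ) (C : ℝ → ℝ → Prop) {X : Type*}
    [MeasurableSpace X] {Γ : X → ℝ → ℝ} (hΓ : ∀ s, Measurable fun x => Γ x s) :
    Measurable fun x => intervalVarRat φ C (Γ x) := by
  unfold intervalVarRat
  refine Measurable.iSup fun n => Measurable.iSup fun α => Measurable.iSup fun β =>
    Measurable.iSup_Prop _ <| Measurable.iSup_Prop _ <| Finset.measurable_sum _ fun i _ => ?_
  exact (hφ.continuous_abs.measurable.comp ((hΓ _).sub (hΓ _))).ennreal_ofReal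

lemma aemeasurable_intervalVar {φ : ℝ → ℝ} (hφ : IsPhiFun φ) {C : ℝ → ℝ → Prop}
    (hC : IsOpen {p : ℝ × ℝ | C p.1 p.2}) {X : Type*} [MeasurableSpace X] {m : Measure X}
    {Γ : X → ℝ → ℝ} (hΓ : ∀ s, Measurable fun x => Γ x s) (hc : ∀ᵐ x ∂m, Continuous (Γ x)) :
    AEMeasurable (fun x => intervalVar φ C (Γ x)) m :=
  ⟨_, measurable_intervalVarRat hφ C hΓ, hc.mono fun _ hx => intervalVar_eq_intervalVarRat hφ hC hx⟩

/-- `g` has small `φ`-variation on all sufficiently fine families of non-overlapping intervals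
contained in a given bounded set. -/
def VanishingFineVar (φ : ℝ → ℝ) (g : ℝ → ℝ) : Prop :=
  ∀ R : ℝ, ∀ ε : ℝ≥0∞, 0 < ε → ∃ η > 0,
    intervalVar φ (fun α β => -R ≤ α ∧ β ≤ R ∧ β - α ≤ η) g ≤ ε

lemma VanishingFineVar.continuous {φ : ℝ → ℝ} (hφ : IsPhiFun φ) {g : ℝ → ℝ}
    (hg : VanishingFineVar φ g) : Continuous g := by
  refine continuous_iff_continuousAt.2 fun x => ?_
  rw [ContinuousAt, tendsto_iff_norm_sub_tendsto_zero]
  refine (tendsto_zero_iff_norm_tendsto_zero.1 ?_)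
  apply hφ.tendsto_zero_of_map_abs
  have : Tendsto (fun y => ENNReal.ofReal (φ |g y - g x|)) (nhds x) (nhds 0) := by
    rw [ENNReal.tendsto_nhds_zero]
    intro ε hε
    obtain ⟨η, hη, H⟩ := hg (|x| + 1) ε hε
    filter_upwards [Metric.ball_mem_nhds x (lt_min hη one_pos)] with y hy
    rw [Metric.mem_ball, Real.dist_eq, lt_min_iff] at hy
    obtain ⟨hy1, hy2⟩ := hy
    rw [abs_lt] at hy1 hy2
    have hx1 := neg_abs_le x
    have hx2 := le_abs_self x
    refine le_trans ?_ H
    rcases le_total x y with hxy | hxy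
    · simpa using sum_le_intervalVar φ g (C := fun α β => -(|x| + 1) ≤ α ∧ β ≤ |x| + 1 ∧ β - α ≤ η)
        {()} (α := fun _ => x) (β := fun _ => y)
        (fun _ _ => ⟨hxy, by linarith, by linarith, by linarith⟩) (by simp)
    · rw [abs_sub_comm]
      simpa using sum_le_intervalVar φ g (C := fun α β => -(|x| + 1) ≤ α ∧ β ≤ |x| + 1 ∧ β - α ≤ η)
        {()} (α := fun _ => y) (β := fun _ => x)
        (fun _ _ => ⟨hxy, by linarith, by linarith, by linarith⟩) (by simp)
  have h2 := (ENNReal.tendsto_toReal ENNReal.zero_ne_top).comp this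
  simpa [Function.comp_def, ENNReal.toReal_ofReal (hφ.nonneg (abs_nonneg _))] using h2

/-- Intervals that are short or lie far from the origin, at scale `m`. -/
def ShortOrFar (m : ℕ) (α β : ℝ) : Prop :=
  β - α < 1 / ((m : ℝ) + 1) ∨ β < -m ∨ (m : ℝ) < α

lemma isOpen_shortOrFar (m : ℕ) : IsOpen {p : ℝ × ℝ | ShortOrFar m p.1 p.2} := by
  have h1 : IsOpen {p : ℝ × ℝ | p.2 - p.1 < 1 / ((m : ℝ) + 1)} :=
    isOpen_lt (by fun_prop) (by fun_prop)
  have h2 : IsOpen {p : ℝ × ℝ | p.2 < -m} := isOpen_lt (by fun_prop) (by fun_prop)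
  have h3 : IsOpen {p : ℝ × ℝ | (m : ℝ) < p.1} := isOpen_lt (by fun_prop) (by fun_prop)
  exact h1.union (h2.union h3)

lemma intervalVar_shortOrFar_shift_le (φ : ℝ → ℝ) (g : ℝ → ℝ) (m : ℕ) {s : ℝ} (hs : |s| ≤ 1) :
    intervalVar φ (ShortOrFar (m + 1)) (fun x => g (x + s)) ≤ intervalVar φ (ShortOrFar m) g := by
  rw [abs_le] at hs
  refine intervalVar_mono_of_map (e := fun x => x + s) (fun x y h => by simpa using h) ?_
    (fun _ _ => le_rfl)
  intro α β _ h
  unfold ShortOrFar at *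
  push_cast at h
  rcases h with h | h | h
  · left
    have : 1 / ((m : ℝ) + 1 + 1) ≤ 1 / ((m : ℝ) + 1) :=
      one_div_le_one_div_of_le (by positivity) (by linarith)
    linarith
  · right; left; linarith
  · right; right; linarith

/-- The variation far from the origin of a function of bounded variation is small. -/
lemma exists_intervalVar_far_le (φ : ℝ → ℝ) {g : ℝ → ℝ}
    (hg : intervalVar φ (fun _ _ => True) g ≠ ⊤) {ε : ℝ≥0∞} (hε : 0 < ε) :
    ∃ R : ℝ, 0 ≤ R ∧ intervalVar φ (fun α β => β ≤ -R ∨ R ≤ α) g ≤ ε := by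
  set V := intervalVar φ (fun _ _ => True) g with hV
  obtain ⟨v, hv, hv'⟩ := exists_seq_tendsto_intervalVar φ (fun _ _ => True) g
  obtain ⟨N, hN⟩ : ∃ N, V ≤ v N + ε := by
    rcases eq_or_ne V 0 with h0 | h0
    · exact ⟨0, by simp [h0]⟩
    · have : V - ε < V := ENNReal.sub_lt_self hg h0 hε.ne'
      obtain ⟨N, hN⟩ := (hv.eventually (lt_mem_nhds this)).exists
      exact ⟨N, tsub_le_iff_right.1 hN.le⟩
  obtain ⟨n, α, β, h1, h2, h3⟩ := hv' N
  obtain ⟨R, hR⟩ : ∃ R : ℝ, 0 ≤ R ∧ ∀ i, -R ≤ α i ∧ β i ≤ R := by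
    refine ⟨∑ i, (|α i| + |β i|), Finset.sum_nonneg fun i _ => by positivity, fun i => ?_⟩
    have := Finset.single_le_sum (f := fun i => |α i| + |β i|) (fun i _ => by positivity)
      (Finset.mem_univ i)
    have h3 := neg_abs_le (α i)
    have h4 := le_abs_self (β i)
    have h5 := abs_nonneg (α i)
    have h6 := abs_nonneg (β i)
    constructor <;> linarith
  refine ⟨R, hR.1, ?_⟩
  have hle : intervalVar φ (fun a b => -R ≤ a ∧ b ≤ R) g +
      intervalVar φ (fun α β => β ≤ -R ∨ R ≤ α) g ≤ V := by
    have := sum_intervalVar_le φ (Finset.univ : Finset Bool)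
      (C := fun k => if k then (fun a b => -R ≤ a ∧ b ≤ R) else (fun α β => β ≤ -R ∨ R ≤ α))
      (C₀ := fun _ _ => True) g (fun _ _ _ _ _ _ => trivial) ?_
    · simpa using this
    · rintro (_ | _) - (_ | _) - hkl a b a' b' hab hab' h h'
      · exact absurd rfl hkl
      · simp only [Bool.false_eq_true, if_false, if_true] at h h'
        rcases h with h | h
        · left; linarith
        · right; linarith
      · simp only [Bool.false_eq_true, if_false, if_true] at h h'
        rcases h' with h' | h'
        · right; linarith
        · left; linarith
      · exact absurd rfl hkl
  have hvN : v N ≤ intervalVar φ (fun a b => -R ≤ a ∧ b ≤ R) g := by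
    rw [h3]
    exact le_intervalVar φ g (fun i => ⟨(h1 i).1, hR.2 i⟩) h2
  have hfin : v N ≠ ⊤ := ne_top_of_le_ne_top hg (hvN.trans (le_self_add.trans hle))
  have : v N + intervalVar φ (fun α β => β ≤ -R ∨ R ≤ α) g ≤ v N + ε :=
    (add_le_add_left hvN _).trans (hle.trans hN)
  exact (ENNReal.add_le_add_iff_left hfin).1 this

lemma intervalVar_or_le (φ : ℝ → ℝ) (C C' : ℝ → ℝ → Prop) (g : ℝ → ℝ) :
    intervalVar φ (fun α β => C α β ∨ C' α β) g ≤ intervalVar φ C g + intervalVar φ C' g := by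
  classical
  refine intervalVar_le fun n α β h1 h2 => ?_
  rw [← Finset.sum_filter_add_sum_filter_not Finset.univ (fun i => C (α i) (β i))]
  refine add_le_add (sum_le_intervalVar φ g _ ?_ fun i _ k _ h => h2 h)
    (sum_le_intervalVar φ g _ ?_ fun i _ k _ h => h2 h)
  · intro i hi
    exact ⟨(h1 i).1, (Finset.mem_filter.1 hi).2⟩
  · intro i hi
    exact ⟨(h1 i).1, (h1 i).2.resolve_left (Finset.mem_filter.1 hi).2⟩

lemma tendsto_intervalVar_shortOrFar (φ : ℝ → ℝ) {g : ℝ → ℝ} (hg : VanishingFineVar φ g)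
    (hfin : intervalVar φ (fun _ _ => True) g ≠ ⊤) :
    Tendsto (fun m => intervalVar φ (ShortOrFar m) g) atTop (nhds 0) := by
  rw [ENNReal.tendsto_nhds_zero]
  intro ε hε
  have hε2 : 0 < ε / 2 := ENNReal.half_pos hε.ne'
  obtain ⟨R, hR0, hR⟩ := exists_intervalVar_far_le φ hfin hε2
  obtain ⟨η, hη, H⟩ := hg (R + 1) (ε / 2) hε2
  have hm1 := (tendsto_one_div_add_atTop_nhds_zero_nat (𝕜 := ℝ)).eventually (gt_mem_nhds hη)
  have hm2 := tendsto_natCast_atTop_atTop (R := ℝ) |>.eventually (eventually_ge_atTop R)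
  filter_upwards [hm1, hm2] with m h1 h2
  refine le_trans ?_ ((intervalVar_or_le φ _ _ g).trans
    ((add_le_add hR H).trans (ENNReal.add_halves ε).le))
  refine intervalVar_mono g fun α β hαβ h => ?_
  have hm1 : 1 / ((m : ℝ) + 1) ≤ 1 := by
    rw [div_le_one (by positivity)]; linarith [Nat.cast_nonneg (α := ℝ) m]
  by_contra! hc
  obtain ⟨⟨hc1, hc2⟩, hc3⟩ := hc
  rcases h with h | h | h
  · exact absurd (hc3 (by linarith) (by linarith)) (by linarith)
  · linarith
  · linarith

lemma exists_finset_grid (m : ℕ) : ∃ S : Finset ℝ, ∀ α β, α ≤ β → ¬ ShortOrFar m α β →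
    ∃ p ∈ S, ∃ q ∈ S, α ≤ p ∧ p ≤ q ∧ q ≤ β ∧ ShortOrFar m α p ∧ ShortOrFar m q β := by
  set t : ℝ := 1 / (2 * ((m : ℝ) + 1)) with ht
  set K : ℤ := 2 * ((m : ℤ) + 1) ^ 2 with hK
  have ht0 : 0 < t := by positivity
  have h2t : 1 / ((m : ℝ) + 1) = 2 * t := by rw [ht]; field_simp
  have hKt : (K : ℝ) * t = m + 1 := by rw [ht, hK]; push_cast; field_simp
  refine ⟨(Finset.Icc (-K) K).image fun k : ℤ => (k : ℝ) * t, fun α β _ h => ?_⟩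
  unfold ShortOrFar at h ⊢
  push Not at h
  obtain ⟨h1, h2, h3⟩ := h
  rw [h2t] at h1 ⊢
  have hα1 : α ≤ ⌈α / t⌉ * t := (div_le_iff₀ ht0).1 (Int.le_ceil _)
  have hα2 : (⌈α / t⌉ : ℝ) * t < α + t := by
    have := mul_lt_mul_of_pos_right (Int.ceil_lt_add_one (α / t)) ht0
    rwa [add_mul, div_mul_cancel₀ _ ht0.ne', one_mul] at this
  have hβ1 : (⌊β / t⌋ : ℝ) * t ≤ β := (le_div_iff₀ ht0).1 (Int.floor_le _)
  have hβ2 : β - t < ⌊β / t⌋ * t := by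
    have := mul_lt_mul_of_pos_right (Int.sub_one_lt_floor (β / t)) ht0
    rwa [sub_mul, div_mul_cancel₀ _ ht0.ne', one_mul] at this
  have hcast : ∀ a b : ℤ, (a : ℝ) * t ≤ b * t ↔ a ≤ b := fun a b => by
    rw [mul_le_mul_iff_left₀ ht0]; exact Int.cast_le
  have ht1 : t ≤ 1 := by
    rw [ht, div_le_one (by positivity)]; linarith [Nat.cast_nonneg (α := ℝ) m]
  have hle : ⌈α / t⌉ ≤ ⌊β / t⌋ := by rw [← hcast]; linarith
  have hαK : ⌈α / t⌉ ≤ K := by rw [← hcast]; linarith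
  have hβK : -K ≤ ⌊β / t⌋ := by rw [← hcast]; push_cast; linarith
  have hK0 : 0 ≤ K := by positivity
  have hnegK : ((-K : ℤ) : ℝ) * t = -(m + 1) := by push_cast; linarith
  refine ⟨_, Finset.mem_image_of_mem _ (Finset.mem_Icc.2 (?_ : _ ∧ max ⌈α / t⌉ (-K) ≤ K)),
    _, Finset.mem_image_of_mem _ (Finset.mem_Icc.2 (?_ : -K ≤ min ⌊β / t⌋ K ∧ _)), ?_⟩
  · exact ⟨le_max_right _ _, max_le hαK (by omega)⟩
  · exact ⟨le_min hβK (by omega), min_le_right _ _⟩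
  refine ⟨?_, ?_, ?_, ?_, ?_⟩
  · exact hα1.trans ((hcast _ _).2 (le_max_left _ _))
  · exact (hcast _ _).2 (max_le (le_min hle hαK) (le_min hβK (by omega)))
  · exact le_trans ((hcast _ _).2 (min_le_left _ _)) hβ1
  · rcases max_cases ⌈α / t⌉ (-K) with h | h
    · left; rw [h.1]; linarith
    · right; left; rw [h.1]; linarith
  · rcases min_cases ⌊β / t⌋ K with h | h
    · left; rw [h.1]; linarith
    · right; right; rw [h.1]; linarith

lemma intervalVar_le_shortOrFar_add_grid {φ : ℝ → ℝ} (hφ : IsPhiFun φ) {m : ℕ} {S : Finset ℝ}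
    (hS : ∀ α β, α ≤ β → ¬ ShortOrFar m α β → ∃ p ∈ S, ∃ q ∈ S, α ≤ p ∧ p ≤ q ∧ q ≤ β ∧
      ShortOrFar m α p ∧ ShortOrFar m q β) (h : ℝ → ℝ) :
    intervalVar φ (fun _ _ => True) h ≤ 3 * intervalVar φ (ShortOrFar m) (fun s => 3 * h s) +
      ∑ x ∈ S ×ˢ S, ENNReal.ofReal (φ |3 * (h x.2 - h x.1)|) := by
  classical
  refine intervalVar_le fun n α β h1 h2 => ?_
  set E := intervalVar φ (ShortOrFar m) (fun s => 3 * h s) with hE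
  set bad := Finset.univ.filter fun i => ¬ ShortOrFar m (α i) (β i) with hbad
  have hmem : ∀ i ∈ bad, ¬ ShortOrFar m (α i) (β i) := fun i hi => (Finset.mem_filter.1 hi).2
  have hex : ∀ i, ∃ p q, i ∈ bad → p ∈ S ∧ q ∈ S ∧ α i ≤ p ∧ p ≤ q ∧ q ≤ β i ∧
      ShortOrFar m (α i) p ∧ ShortOrFar m q (β i) := by
    intro i
    by_cases hi : i ∈ bad
    · obtain ⟨p, hp, q, hq, H⟩ := hS _ _ (h1 i).1 (hmem i hi)
      exact ⟨p, q, fun _ => ⟨hp, hq, H⟩⟩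
    · exact ⟨0, 0, fun h => absurd h hi⟩
  choose p q hpq using hex
  have hE' : ∀ (s : Finset (Fin n)) (a b : Fin n → ℝ),
      (∀ i ∈ s, a i ≤ b i ∧ ShortOrFar m (a i) (b i) ∧ α i ≤ a i ∧ b i ≤ β i) →
      ∑ i ∈ s, ENNReal.ofReal (φ |3 * (h (b i) - h (a i))|) ≤ E := by
    intro s a b hab
    simp_rw [mul_sub]
    refine sum_le_intervalVar φ (fun s => 3 * h s) s (fun i hi => ⟨(hab i hi).1, (hab i hi).2.1⟩) ?_
    intro i hi k hk hik
    rcases h2 hik with H | H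
    · exact Or.inl ((hab i hi).2.2.2.trans (H.trans (hab k hk).2.2.1))
    · exact Or.inr ((hab k hk).2.2.2.trans (H.trans (hab i hi).2.2.1))
  have hgood : ∑ i ∈ Finset.univ.filter (fun i => ShortOrFar m (α i) (β i)),
      ENNReal.ofReal (φ |h (β i) - h (α i)|) ≤ E := by
    refine le_trans (Finset.sum_le_sum fun i _ => ENNReal.ofReal_le_ofReal (hφ.map_abs_le ?_))
      (hE' _ α β fun i hi => ⟨(h1 i).1, (Finset.mem_filter.1 hi).2, le_rfl, le_rfl⟩)
    rw [abs_mul, abs_of_pos (by norm_num : (0 : ℝ) < 3)]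
    linarith [abs_nonneg (h (β i) - h (α i))]
  have hmid : ∑ i ∈ bad, ENNReal.ofReal (φ |3 * (h (q i) - h (p i))|) ≤
      ∑ x ∈ S ×ˢ S, ENNReal.ofReal (φ |3 * (h x.2 - h x.1)|) := by
    rw [← Finset.sum_filter_add_sum_filter_not bad (fun i => p i = q i)]
    have hz : ∑ i ∈ bad.filter (fun i => p i = q i),
        ENNReal.ofReal (φ |3 * (h (q i) - h (p i))|) = 0 := by
      refine Finset.sum_eq_zero fun i hi => ?_
      rw [(Finset.mem_filter.1 hi).2]
      simp [hφ.map_zero]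
    rw [hz, zero_add]
    have hinj : Set.InjOn (fun i => (p i, q i)) (bad.filter fun i => ¬ p i = q i) := by
      intro i hi k hk hik
      simp only [Prod.mk.injEq] at hik
      simp only [Finset.coe_filter, mem_ofPred_eq] at hi hk
      by_contra hne
      obtain ⟨-, -, a1, a2, a3, -⟩ := hpq i hi.1
      obtain ⟨-, -, b1, b2, b3, -⟩ := hpq k hk.1
      have hlt := lt_of_le_of_ne a2 hi.2
      rcases h2 hne with H | H <;> linarith [hik.1, hik.2]
    rw [← Finset.sum_image (g := fun i => (p i, q i))
      (f := fun x : ℝ × ℝ => ENNReal.ofReal (φ |3 * (h x.2 - h x.1)|)) hinj]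
    refine Finset.sum_le_sum_of_subset fun x hx => ?_
    obtain ⟨i, hi, rfl⟩ := Finset.mem_image.1 hx
    have := hpq i (Finset.mem_filter.1 hi).1
    exact Finset.mem_product.2 ⟨this.1, this.2.1⟩
  have hb : ∑ i ∈ bad, ENNReal.ofReal (φ |h (β i) - h (α i)|) ≤
      E + ∑ x ∈ S ×ˢ S, ENNReal.ofReal (φ |3 * (h x.2 - h x.1)|) + E := by
    refine le_trans (Finset.sum_le_sum (g := fun i =>
      ENNReal.ofReal (φ |3 * (h (p i) - h (α i))|) + ENNReal.ofReal (φ |3 * (h (q i) - h (p i))|) +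
        ENNReal.ofReal (φ |3 * (h (β i) - h (q i))|)) fun i _ => ?_) ?_
    · refine le_trans (le_of_eq ?_) (hφ.ofReal_map_add_three_le _ _ _)
      ring_nf
    · rw [Finset.sum_add_distrib, Finset.sum_add_distrib]
      refine add_le_add (add_le_add (hE' _ _ _ fun i hi => ?_) hmid) (hE' _ _ _ fun i hi => ?_)
      · obtain ⟨-, -, a1, a2, a3, a4, a5⟩ := hpq i hi
        exact ⟨a1, a4, le_rfl, a2.trans a3⟩
      · obtain ⟨-, -, a1, a2, a3, a4, a5⟩ := hpq i hi
        exact ⟨a3, a5, a1.trans a2, le_rfl⟩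
  rw [← Finset.sum_filter_add_sum_filter_not Finset.univ (fun i => ShortOrFar m (α i) (β i))]
  refine (add_le_add hgood hb).trans (le_of_eq ?_)
  ring

lemma intervalVar_sub_le {φ : ℝ → ℝ} (hφ : IsPhiFun φ) (C : ℝ → ℝ → Prop) (g g' : ℝ → ℝ) {c : ℝ}
    (hc : |c| ≤ 1 / 2) :
    intervalVar φ C (fun s => c * (g' s - g s)) ≤ intervalVar φ C g' + intervalVar φ C g := by
  refine intervalVar_le fun n α β h1 h2 => ?_
  have h0 : ∀ x : ℝ, |2 * (c * x)| ≤ |x| := fun x => by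
    rw [abs_mul, abs_mul, abs_two, ← mul_assoc]
    exact mul_le_of_le_one_left (abs_nonneg _) (by linarith)
  refine le_trans ?_ (add_le_add (le_intervalVar φ g' h1 h2) (le_intervalVar φ g h1 h2))
  rw [← Finset.sum_add_distrib]
  refine Finset.sum_le_sum fun i _ => ?_
  have : c * (g' (β i) - g (β i)) - c * (g' (α i) - g (α i)) =
    c * (g' (β i) - g' (α i)) + -(c * (g (β i) - g (α i))) := by ring
  rw [this]
  refine (hφ.ofReal_map_add_le _ _).trans (add_le_add ?_ ?_)
  · exact ENNReal.ofReal_le_ofReal (hφ.map_abs_le (h0 _))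
  · rw [mul_neg, abs_neg]
    exact ENNReal.ofReal_le_ofReal (hφ.map_abs_le (h0 _))

lemma tendsto_lintegral_enorm_translate_sub {ι : Type*} [Fintype ι] {S : (ι → ℝ) → ℝ}
    (hS : Integrable S volume) :
    Tendsto (fun h => ∫⁻ y, ‖S (y + h) - S y‖ₑ) (nhds 0) (nhds 0) := by
  have hm := memLp_one_iff_integrable.2 hS
  have : Fact ((1 : ℝ≥0∞) ≠ ⊤) := ⟨ENNReal.one_ne_top⟩
  have hc : Continuous fun h : ι → ℝ => (DomAddAct.mk h) +ᵥ hm.toLp S :=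
    (DomAddAct.continuous_mk).vadd continuous_const
  have h0 := tendsto_iff_edist_tendsto_0.1 (hc.tendsto 0)
  refine h0.congr fun h => ?_
  rw [DomAddAct.mk_zero, zero_vadd, DomAddAct.mk_vadd_toLp, Lp.edist_toLp_toLp,
    eLpNorm_one_eq_lintegral_enorm]
  simp [add_comm]

/-- Coordinatewise exponential. -/
def expVec {ι : Type*} (y : ι → ℝ) : ι → ℝ := fun i => Real.exp (y i)

/-- Coordinatewise logarithm. -/
def logVec {ι : Type*} (x : ι → ℝ) : ι → ℝ := fun i => Real.log (x i)

lemma expVec_injective {ι : Type*} : Function.Injective (expVec : (ι → ℝ) → ι → ℝ) :=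
  fun _ _ h => funext fun i => Real.exp_injective (congrFun h i)

lemma expVec_logVec {ι : Type*} {x : ι → ℝ} (hx : ∀ i, 0 < x i) : expVec (logVec x) = x :=
  funext fun i => Real.exp_log (hx i)

lemma measurable_expVec {ι : Type*} : Measurable (expVec : (ι → ℝ) → ι → ℝ) :=
  measurable_pi_lambda _ fun i => Real.measurable_exp.comp (measurable_pi_apply i)

lemma image_expVec_univ {ι : Type*} :
    expVec '' (univ : Set (ι → ℝ)) = {x | ∀ i, 0 < x i} := by
  ext x
  constructor
  · rintro ⟨y, -, rfl⟩ i
    exact Real.exp_pos _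
  · intro hx
    exact ⟨logVec x, mem_univ _, expVec_logVec hx⟩

lemma image_expVec_Icc {ι : Type*} (a b : ι → ℝ) :
    expVec '' (Set.pi univ fun i => Icc (a i) (b i)) =
      Set.pi univ fun i => Icc (Real.exp (a i)) (Real.exp (b i)) := by
  ext x
  constructor
  · rintro ⟨y, hy, rfl⟩ i _
    exact ⟨Real.exp_le_exp.2 (hy i trivial).1, Real.exp_le_exp.2 (hy i trivial).2⟩
  · intro hx
    have hp : ∀ i, 0 < x i := fun i => (Real.exp_pos _).trans_le (hx i trivial).1
    exact ⟨logVec x, fun i _ => ⟨(Real.le_log_iff_exp_le (hp i)).2 (hx i trivial).1,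
      (Real.log_le_iff_le_exp (hp i)).2 (hx i trivial).2⟩, expVec_logVec hp⟩

/-- The derivative of the coordinatewise exponential. -/
def expVecDeriv {ι : Type*} (y : ι → ℝ) : (ι → ℝ) →L[ℝ] ι → ℝ :=
  ContinuousLinearMap.pi fun i =>
    (ContinuousLinearMap.toSpanSingleton ℝ (Real.exp (y i))).comp (ContinuousLinearMap.proj i)

lemma hasFDerivAt_expVec {ι : Type*} [Fintype ι] (y : ι → ℝ) :
    HasFDerivAt expVec (expVecDeriv y) y :=
  hasFDerivAt_pi.2 fun i => (Real.hasDerivAt_exp (y i)).hasFDerivAt.comp y (hasFDerivAt_apply i y)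

lemma det_expVecDeriv {ι : Type*} [Fintype ι] (y : ι → ℝ) :
    (expVecDeriv y).det = ∏ i, expVec y i := by
  rw [expVecDeriv, ContinuousLinearMap.det_pi]
  simp [expVec]

/-- Logarithmic change of variables; no measurability of the integrand is needed. -/
lemma lintegral_image_expVec {ι : Type*} [Fintype ι] {s : Set (ι → ℝ)} (hs : MeasurableSet s)
    (g : (ι → ℝ) → ℝ≥0∞) :
    ∫⁻ x in expVec '' s, g x * ENNReal.ofReal ((∏ i, x i)⁻¹) = ∫⁻ y in s, g (expVec y) := by
  rw [lintegral_image_eq_lintegral_abs_det_fderiv_mul volume hs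
    (fun y _ => (hasFDerivAt_expVec y).hasFDerivWithinAt) expVec_injective.injOn]
  refine lintegral_congr fun y => ?_
  have hp : 0 < ∏ i, expVec y i := Finset.prod_pos fun i _ => Real.exp_pos _
  rw [det_expVecDeriv, abs_of_pos hp, mul_left_comm, ← ENNReal.ofReal_mul hp.le,
    mul_inv_cancel₀ hp.ne', ENNReal.ofReal_one, mul_one]

lemma ae_expVec {ι : Type*} [Fintype ι] {s : Set (ι → ℝ)} (hs : MeasurableSet s)
    {p : (ι → ℝ) → Prop} (h : ∀ᵐ x ∂(volume.restrict (expVec '' s)), p x) :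
    ∀ᵐ y ∂(volume.restrict s), p (expVec y) := by
  obtain ⟨t, ht, htm, ht0⟩ := exists_measurable_superset_of_null (ae_iff.1 h)
  have h1 : ∫⁻ x in expVec '' s, t.indicator 1 x * ENNReal.ofReal ((∏ i, x i)⁻¹) = 0 := by
    rw [lintegral_congr_ae (g := fun _ => 0), lintegral_zero]
    filter_upwards [measure_eq_zero_iff_ae_notMem.1 ht0] with x hx
    simp [hx]
  rw [lintegral_image_expVec hs] at h1
  filter_upwards [(lintegral_eq_zero_iff
    ((measurable_one.indicator htm).comp measurable_expVec)).1 h1] with y hy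
  by_contra hp
  have : expVec y ∈ t := ht hp
  simp [this] at hy

lemma expVec_insertCoord {N : ℕ} (j : Fin N) (y' : {i : Fin N // i ≠ j} → ℝ) (s : ℝ) :
    expVec (insertCoord j y' s) = insertCoord j (expVec y') (Real.exp s) := by
  funext i
  by_cases h : i = j <;> simp [expVec, insertCoord, h]

lemma phiVar1_comp_exp (φ : ℝ → ℝ) (a b : ℝ) (g : ℝ → ℝ) :
    phiVar1 φ (Real.exp a) (Real.exp b) g = phiVar1 φ a b fun s => g (Real.exp s) := by
  apply le_antisymm
  · refine iSup_le fun n => iSup_le fun u => iSup_le fun hu => iSup_le fun h0 =>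
      iSup_le fun hl => ?_
    have hp : ∀ i, 0 < u i := fun i =>
      (Real.exp_pos a).trans_le (h0 ▸ hu (Fin.zero_le i))
    refine le_iSup_of_le n <| le_iSup_of_le (fun i => Real.log (u i)) <|
      le_iSup_of_le (fun i k hik => Real.log_le_log (hp i) (hu hik)) <|
      le_iSup_of_le (by simp [h0]) <| le_iSup_of_le (by simp [hl]) ?_
    simp only [Real.exp_log (hp _), le_refl]
  · refine iSup_le fun n => iSup_le fun u => iSup_le fun hu => iSup_le fun h0 =>
      iSup_le fun hl => ?_
    exact le_iSup_of_le n <| le_iSup_of_le (fun i => Real.exp (u i)) <|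
      le_iSup_of_le (fun i k hik => Real.exp_le_exp.2 (hu hik)) <|
      le_iSup_of_le (by simp [h0]) <| le_iSup_of_le (by simp [hl]) le_rfl

/-- The total variation of the `j`-th sections of `f`, in logarithmic coordinates. -/
def logSecVar {N : ℕ} (φ : ℝ → ℝ) (f : (Fin N → ℝ) → ℝ) (j : Fin N) : ℝ≥0∞ :=
  ∫⁻ y', intervalVar φ (fun _ _ => True) fun s => f (expVec (insertCoord j y' s))

lemma sum_lintegral_le {X : Type*} [MeasurableSpace X] (ν : Measure X) {κ : Type*} (s : Finset κ)
    (F : κ → X → ℝ≥0∞) : ∑ k ∈ s, ∫⁻ x, F k x ∂ν ≤ ∫⁻ x, ∑ k ∈ s, F k x ∂ν := by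
  classical
  induction s using Finset.induction_on with
  | empty => simp
  | insert k s hk ih =>
    simp only [Finset.sum_insert hk]
    exact (add_le_add le_rfl ih).trans (le_lintegral_add _ _)

lemma boxPhi_le_sum {N : ℕ} (φ : ℝ → ℝ) (f : (Fin N → ℝ) → ℝ) (a b : Fin N → ℝ) :
    boxPhi φ f a b ≤ ∑ j, secVar φ f a b j := by
  have h : ∑ j, secVar φ f a b j ^ 2 ≤ (∑ j, secVar φ f a b j) ^ 2 := by
    rw [sq (∑ j, _), Finset.sum_mul]
    refine Finset.sum_le_sum fun j hj => ?_
    rw [sq]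
    gcongr
    exact Finset.single_le_sum (f := fun j => secVar φ f a b j) (fun _ _ => zero_le) hj
  refine (ENNReal.rpow_le_rpow h (by norm_num : (0 : ℝ) ≤ 1 / 2)).trans ?_
  rw [← ENNReal.rpow_natCast, ← ENNReal.rpow_mul]
  norm_num

lemma secVar_le_boxPhi {N : ℕ} (φ : ℝ → ℝ) (f : (Fin N → ℝ) → ℝ) (a b : Fin N → ℝ) (j : Fin N) :
    secVar φ f a b j ≤ boxPhi φ f a b := by
  have h : secVar φ f a b j ^ 2 ≤ ∑ j, secVar φ f a b j ^ 2 :=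
    Finset.single_le_sum (f := fun j => secVar φ f a b j ^ 2) (fun _ _ => zero_le)
      (Finset.mem_univ j)
  refine le_trans ?_ (ENNReal.rpow_le_rpow h (by norm_num : (0 : ℝ) ≤ 1 / 2))
  rw [← ENNReal.rpow_natCast, ← ENNReal.rpow_mul]
  norm_num

lemma IsBoxPartition.left_le {N m : ℕ} {a b : Fin N → ℝ} {c d : Fin m → Fin N → ℝ}
    (h : IsBoxPartition a b c d) (k : Fin m) (i : Fin N) : a i ≤ c k i := by
  have : c k ∈ ⋃ k, Set.pi univ fun i => Icc (c k i) (d k i) :=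
    mem_iUnion.2 ⟨k, fun i _ => ⟨le_rfl, h.1 k i⟩⟩
  rw [h.2.1] at this
  exact (this i trivial).1

lemma intervalVar_eq_zero_of_le {φ : ℝ → ℝ} (hφ : IsPhiFun φ) {C : ℝ → ℝ → Prop}
    (hC : ∀ α β, C α β → β ≤ α) (g : ℝ → ℝ) : intervalVar φ C g = 0 := by
  refine le_antisymm (intervalVar_le fun n α β h1 _ => ?_) zero_le
  refine (Finset.sum_eq_zero fun i _ => ?_).le
  rw [le_antisymm (hC _ _ (h1 i).2) (h1 i).1]
  simp [hφ.map_zero]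

/-- Above a point off the faces of a box partition, the variations of a section over the boxes
add up to at most its total variation. -/
lemma sum_indicator_phiVar1_le {φ : ℝ → ℝ} (hφ : IsPhiFun φ) {N m : ℕ} {a b : Fin N → ℝ}
    {c d : Fin m → Fin N → ℝ} (ha : ∀ i, 0 < a i) (h : IsBoxPartition a b c d) (j : Fin N)
    {x' : {i : Fin N // i ≠ j} → ℝ} (hx : ∀ k i, x' i ≠ c k i ∧ x' i ≠ d k i) (g : ℝ → ℝ) :
    ∑ k, (Set.pi univ fun i : {i : Fin N // i ≠ j} => Icc (c k i) (d k i)).indicator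
      (fun _ => phiVar1 φ (c k j) (d k j) g) x' ≤
    intervalVar φ (fun _ _ => True) fun s => g (Real.exp s) := by
  classical
  have hc : ∀ k i, 0 < c k i := fun k i => (ha i).trans_le (h.left_le k i)
  have hd : ∀ k i, 0 < d k i := fun k i => (hc k i).trans_le (h.1 k i)
  set D : Fin m → ℝ → ℝ → Prop := fun k α β => Real.log (c k j) ≤ α ∧ β ≤ Real.log (d k j)
  set S : Finset (Fin m) := Finset.univ.filter fun k =>
    (∀ i : {i : Fin N // i ≠ j}, x' i ∈ Icc (c k i) (d k i)) ∧ c k j < d k j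
  have hle : ∀ k, phiVar1 φ (c k j) (d k j) g ≤ intervalVar φ (D k) fun s => g (Real.exp s) := by
    intro k
    rw [← Real.exp_log (hc k j), ← Real.exp_log (hd k j), phiVar1_comp_exp]
    simpa only [D, Real.exp_log (hc k j), Real.exp_log (hd k j)] using
      phiVar1_le_intervalVar φ (Real.log (c k j)) (Real.log (d k j)) fun s => g (Real.exp s)
  have hsum : ∑ k, (Set.pi univ fun i : {i : Fin N // i ≠ j} => Icc (c k i) (d k i)).indicator
      (fun _ => phiVar1 φ (c k j) (d k j) g) x' ≤
      ∑ k ∈ S, intervalVar φ (D k) fun s => g (Real.exp s) := by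
    rw [Finset.sum_filter]
    refine Finset.sum_le_sum fun k _ => ?_
    by_cases hk : ∀ i : {i : Fin N // i ≠ j}, x' i ∈ Icc (c k i) (d k i)
    · rw [indicator_of_mem (mem_univ_pi.2 hk)]
      rcases (h.1 k j).lt_or_eq with hlt | heq
      · rw [if_pos ⟨hk, hlt⟩]
        exact hle k
      · refine ((hle k).trans_eq (intervalVar_eq_zero_of_le hφ (fun α β hαβ => ?_) _)).trans zero_le
        exact hαβ.2.trans (heq ▸ hαβ.1)
    · rw [indicator_of_notMem (fun hk' => hk (mem_univ_pi.1 hk'))]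
      exact zero_le
  refine hsum.trans (sum_intervalVar_le φ S _ (fun _ _ _ _ _ _ => trivial) ?_)
  intro k hk l hl hkl α β α' β' _ _ hC hC'
  simp only [S, Finset.mem_filter, Finset.mem_univ, true_and] at hk hl
  have key : d k j ≤ c l j ∨ d l j ≤ c k j := by
    by_contra! hcon
    obtain ⟨p, hp1, hp2⟩ := exists_between
      (show max (c k j) (c l j) < min (d k j) (d l j) from
        max_lt (lt_min hk.2 hcon.2) (lt_min hcon.1 hl.2))
    have hmem : ∀ q, (∀ i : {i : Fin N // i ≠ j}, x' i ∈ Icc (c q i) (d q i)) → c q j < p →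
        p < d q j → insertCoord j x' p ∈ Set.pi univ fun i => Ioo (c q i) (d q i) := by
      intro q hq h1 h2 i _
      by_cases hi : i = j
      · subst hi
        simp [insertCoord, h1, h2]
      · simp only [insertCoord, hi, dite_false]
        exact ⟨lt_of_le_of_ne (hq ⟨i, hi⟩).1 (hx q ⟨i, hi⟩).1.symm,
          lt_of_le_of_ne (hq ⟨i, hi⟩).2 (hx q ⟨i, hi⟩).2⟩
    exact Set.disjoint_left.1 (h.2.2 hkl)
      (hmem k hk.1 ((le_max_left _ _).trans_lt hp1) (hp2.trans_le (min_le_left _ _)))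
      (hmem l hl.1 ((le_max_right _ _).trans_lt hp1) (hp2.trans_le (min_le_right _ _)))
  rcases key with hkey | hkey
  · exact Or.inl (hC.2.trans ((Real.log_le_log (hd k j) hkey).trans hC'.1))
  · exact Or.inr (hC'.2.trans ((Real.log_le_log (hd l j) hkey).trans hC.1))

lemma sum_secVar_le_logSecVar {φ : ℝ → ℝ} (hφ : IsPhiFun φ) {N m : ℕ} (f : (Fin N → ℝ) → ℝ)
    {a b : Fin N → ℝ} {c d : Fin m → Fin N → ℝ} (ha : ∀ i, 0 < a i) (h : IsBoxPartition a b c d)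
    (j : Fin N) : ∑ k, secVar φ f (c k) (d k) j ≤ logSecVar φ f j := by
  have hms : ∀ k, MeasurableSet
      (Set.pi univ fun i : {i : Fin N // i ≠ j} => Icc (c k i) (d k i)) :=
    fun k => MeasurableSet.univ_pi fun i => measurableSet_Icc
  have hpos : MeasurableSet {x : {i : Fin N // i ≠ j} → ℝ | ∀ i, 0 < x i} := by
    have : {x : {i : Fin N // i ≠ j} → ℝ | ∀ i, 0 < x i} = Set.pi univ fun _ => Ioi 0 := by
      ext; simp
    rw [this]
    exact MeasurableSet.univ_pi fun i => measurableSet_Ioi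
  have e : logSecVar φ f j = ∫⁻ x' in expVec '' univ,
      intervalVar φ (fun _ _ => True) (fun s => f (insertCoord j x' (Real.exp s))) *
        ENNReal.ofReal ((∏ i, x' i)⁻¹) := by
    rw [lintegral_image_expVec MeasurableSet.univ, Measure.restrict_univ]
    simp only [logSecVar, expVec_insertCoord]
  have hface : ∀ᵐ x' : {i : Fin N // i ≠ j} → ℝ, ∀ k i, x' i ≠ c k i ∧ x' i ≠ d k i := by
    refine ae_all_iff.2 fun k => ae_all_iff.2 fun i => ?_
    exact (Measure.ae_eval_ne _ i _).and (Measure.ae_eval_ne _ i _)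
  rw [e, image_expVec_univ, ← lintegral_indicator hpos]
  simp only [secVar, ← lintegral_indicator (hms _)]
  refine (sum_lintegral_le _ _ _).trans (lintegral_mono_ae ?_)
  filter_upwards [hface] with x' hx
  by_cases hx' : ∀ i, 0 < x' i
  · rw [indicator_of_mem (by exact hx')]
    have := sum_indicator_phiVar1_le hφ ha h j hx fun s => f (insertCoord j x' s)
    refine le_trans ?_ (mul_le_mul_left this _)
    rw [Finset.sum_mul]
    refine (Finset.sum_congr rfl fun k _ => ?_).le
    by_cases hk : x' ∈ Set.pi univ fun i : {i : Fin N // i ≠ j} => Icc (c k i) (d k i)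
    · simp only [indicator_of_mem hk]
    · simp only [indicator_of_notMem hk, zero_mul]
  · refine (Finset.sum_eq_zero fun k _ => indicator_of_notMem (fun hk => hx' fun i => ?_) _).le.trans
      zero_le
    exact ((ha i).trans_le (h.left_le k i)).trans_le (hk i trivial).1

/-- The multidimensional variation is controlled by the total variations of the sections. -/
lemma totalVar_le_sum_logSecVar {φ : ℝ → ℝ} (hφ : IsPhiFun φ) {N : ℕ} (f : (Fin N → ℝ) → ℝ) :
    totalVar φ f ≤ ∑ j, logSecVar φ f j := by
  refine iSup_le fun a => iSup_le fun b => iSup_le fun ha => iSup_le fun _ => ?_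
  refine iSup_le fun m => iSup_le fun c => iSup_le fun d => iSup_le fun h => ?_
  refine (Finset.sum_le_sum fun k _ => boxPhi_le_sum φ f (c k) (d k)).trans ?_
  rw [Finset.sum_comm]
  exact Finset.sum_le_sum fun j _ => sum_secVar_le_logSecVar hφ f ha h j

lemma LocACphiWith.mono {φ : ℝ → ℝ} (hφ : IsPhiFun φ) {N : ℕ} {f : (Fin N → ℝ) → ℝ} {l l' : ℝ}
    (h : LocACphiWith φ f l) (hl : 0 ≤ l') (hl' : l' ≤ l) : LocACphiWith φ f l' := by
  intro a b ha hab j ε hε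
  obtain ⟨δ, hδ, H⟩ := h a b ha hab j ε hε
  refine ⟨δ, hδ, H.mono fun x' hx n α β h1 h2 h3 => ?_⟩
  refine lt_of_le_of_lt (Finset.sum_le_sum fun i _ => ?_) (hx n α β h1 h2 h3)
  exact hφ.monotoneOn (mem_Ici.2 (mul_nonneg hl (abs_nonneg _)))
    (mem_Ici.2 (mul_nonneg (hl.trans hl') (abs_nonneg _)))
    (mul_le_mul_of_nonneg_right hl' (abs_nonneg _))

lemma exp_sub_exp_le {α β R : ℝ} (h : α ≤ β) (hR : β ≤ R) :
    Real.exp β - Real.exp α ≤ Real.exp R * (β - α) := by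
  have h1 : Real.exp β * (α - β + 1) ≤ Real.exp α := by
    calc Real.exp β * (α - β + 1) ≤ Real.exp β * Real.exp (α - β) := by
          gcongr
          exact Real.add_one_le_exp _
      _ = Real.exp α := by rw [← Real.exp_add]; congr 1; ring
  have h2 : Real.exp β * (β - α) ≤ Real.exp R * (β - α) :=
    mul_le_mul_of_nonneg_right (Real.exp_le_exp.2 hR) (sub_nonneg.2 h)
  linarith

/-- Almost every section of a locally `φ`-absolutely continuous function has vanishing fine
variation, in logarithmic coordinates. -/
lemma LocACphiWith.ae_vanishingFineVar {φ : ℝ → ℝ} (hφ : IsPhiFun φ) {N : ℕ}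
    {f : (Fin N → ℝ) → ℝ} {l : ℝ} (hl : 0 < l) (h : LocACphiWith φ f l) (j : Fin N) :
    ∀ᵐ y' : {i : Fin N // i ≠ j} → ℝ,
      VanishingFineVar φ fun s => l * f (expVec (insertCoord j y' s)) := by
  have H := fun k m : ℕ => h (fun _ => Real.exp (-k)) (fun _ => Real.exp k)
    (fun _ => Real.exp_pos _) (fun _ => Real.exp_le_exp.2 (by linarith [k.cast_nonneg (α := ℝ)]))
    j (1 / (m + 1)) (by positivity)
  choose δ hδ hae using H
  have hms : ∀ k : ℕ, MeasurableSet
      (Set.pi univ fun _ : {i : Fin N // i ≠ j} => Icc (-(k : ℝ)) k) :=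
    fun k => MeasurableSet.univ_pi fun i => measurableSet_Icc
  have hae' := fun k m : ℕ => (ae_restrict_iff' (hms k)).1 <| ae_expVec (hms k) <| by
    have := hae k m
    rwa [← image_expVec_Icc (fun _ => -(k : ℝ)) (fun _ => (k : ℝ))] at this
  filter_upwards [ae_all_iff.2 fun k => ae_all_iff.2 fun m => hae' k m] with y' hy R ε hε
  obtain ⟨k, hk⟩ := exists_nat_ge (max R ‖y'‖)
  obtain ⟨m, hm⟩ : ∃ m : ℕ, ENNReal.ofReal (1 / ((m : ℝ) + 1)) ≤ ε := by
    have ht : Tendsto (fun m : ℕ => ENNReal.ofReal (1 / ((m : ℝ) + 1))) atTop (nhds 0) := by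
      simpa using ENNReal.tendsto_ofReal tendsto_one_div_add_atTop_nhds_zero_nat
    exact (ht.eventually_le_const hε).exists
  have hbox : y' ∈ Set.pi univ fun _ : {i : Fin N // i ≠ j} => Icc (-(k : ℝ)) k := fun i _ => by
    have := (norm_le_pi_norm y' i).trans ((le_max_right _ _).trans hk)
    exact abs_le.1 this
  have hP := hy k m hbox
  have hE : 0 < Real.exp k := Real.exp_pos _
  have hk0 : (0 : ℝ) ≤ k := k.cast_nonneg
  obtain ⟨η, hη, hηφ⟩ := hφ.exists_le_mul (show 0 < δ k m / (Real.exp k * (2 * k + 1)) from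
    div_pos (hδ k m) (by positivity))
  refine ⟨η / (2 * Real.exp k), by positivity, intervalVar_le fun n α β h1 h2 => ?_⟩
  have hR : R ≤ k := (le_max_left _ _).trans hk
  have hα : ∀ i, -(k : ℝ) ≤ α i := fun i => by linarith [(h1 i).2.1]
  have hβ : ∀ i, β i ≤ k := fun i => by linarith [(h1 i).2.2.1]
  have hlen : ∀ i, Real.exp (β i) - Real.exp (α i) ≤ Real.exp k * (β i - α i) := fun i =>
    exp_sub_exp_le (h1 i).1 (hβ i)
  have hlen0 : ∀ i, 0 ≤ Real.exp (β i) - Real.exp (α i) := fun i =>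
    sub_nonneg.2 (Real.exp_le_exp.2 (h1 i).1)
  have hsmall : ∀ i, Real.exp (β i) - Real.exp (α i) < η := fun i => by
    refine (hlen i).trans_lt ?_
    have : Real.exp k * (β i - α i) ≤ Real.exp k * (η / (2 * Real.exp k)) :=
      mul_le_mul_of_nonneg_left (h1 i).2.2.2 hE.le
    have e : Real.exp k * (η / (2 * Real.exp k)) = η / 2 := by field_simp
    linarith
  have hsum : ∑ i, φ (Real.exp (β i) - Real.exp (α i)) < δ k m := by
    calc ∑ i, φ (Real.exp (β i) - Real.exp (α i))
        ≤ ∑ i, δ k m / (Real.exp k * (2 * k + 1)) * (Real.exp k * (β i - α i)) := by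
          refine Finset.sum_le_sum fun i _ => (hηφ _ (hlen0 i) (hsmall i)).trans ?_
          exact mul_le_mul_of_nonneg_left (hlen i) (div_nonneg (hδ k m).le (by positivity))
      _ = δ k m / (2 * k + 1) * ∑ i, (β i - α i) := by
          rw [Finset.mul_sum]
          refine Finset.sum_congr rfl fun i _ => ?_
          field_simp
      _ ≤ δ k m / (2 * k + 1) * (k - -k) := by
          refine mul_le_mul_of_nonneg_left ?_ (div_nonneg (hδ k m).le (by positivity))
          exact sum_sub_le_of_nonoverlap (by linarith) (fun i => ⟨hα i, (h1 i).1, hβ i⟩) h2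
      _ < δ k m := by
          have h2k : (0 : ℝ) < 2 * k + 1 := by positivity
          rw [div_mul_eq_mul_div, div_lt_iff₀ h2k]
          nlinarith [hδ k m]
  have hfin := hP n (fun i => Real.exp (α i)) (fun i => Real.exp (β i))
    (fun i => ⟨Real.exp_le_exp.2 (hα i), Real.exp_le_exp.2 (h1 i).1, Real.exp_le_exp.2 (hβ i)⟩)
    (fun i i' hii => by
      refine Ioo_disjoint_Ioo.2 ?_
      rcases h2 hii with hc | hc
      · exact (min_le_left _ _).trans ((Real.exp_le_exp.2 hc).trans (le_max_right _ _))
      · exact (min_le_right _ _).trans ((Real.exp_le_exp.2 hc).trans (le_max_left _ _))) hsum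
  refine le_trans ?_ hm
  rw [← ENNReal.ofReal_sum_of_nonneg fun i _ => hφ.nonneg (abs_nonneg _)]
  refine ENNReal.ofReal_le_ofReal (le_trans (Finset.sum_le_sum fun i _ => ?_) hfin.le)
  rw [← mul_sub, abs_mul, abs_of_pos hl, expVec_insertCoord, expVec_insertCoord]

lemma measurable_insertCoord {N : ℕ} (j : Fin N) :
    Measurable fun p : ({i : Fin N // i ≠ j} → ℝ) × ℝ => insertCoord j p.1 p.2 := by
  refine measurable_pi_lambda _ fun i => ?_
  by_cases h : i = j
  · simpa [insertCoord, h] using measurable_snd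
  · simp only [insertCoord, h, dite_false]
    exact (measurable_pi_apply _).comp measurable_fst

lemma secVar_exp {N : ℕ} (φ : ℝ → ℝ) (f : (Fin N → ℝ) → ℝ) (a b : Fin N → ℝ) (j : Fin N) :
    secVar φ f (expVec a) (expVec b) j =
      ∫⁻ y' in Set.pi univ fun i : {i : Fin N // i ≠ j} => Icc (a i) (b i),
        phiVar1 φ (a j) (b j) fun s => f (expVec (insertCoord j y' s)) := by
  have h1 := image_expVec_Icc (fun i : {i : Fin N // i ≠ j} => a i) (fun i => b i)
  have h2 := lintegral_image_expVec (s := Set.pi univ fun i : {i : Fin N // i ≠ j} =>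
    Icc (a i) (b i)) (MeasurableSet.univ_pi fun i => measurableSet_Icc)
    fun x' => phiVar1 φ (Real.exp (a j)) (Real.exp (b j)) fun s => f (insertCoord j x' s)
  rw [h1] at h2
  refine h2.trans (lintegral_congr fun y' => ?_)
  rw [phiVar1_comp_exp]
  simp only [expVec_insertCoord]

lemma secVar_le_totalVar {N : ℕ} (φ : ℝ → ℝ) (f : (Fin N → ℝ) → ℝ) {a b : Fin N → ℝ}
    (ha : ∀ i, 0 < a i) (hab : ∀ i, a i ≤ b i) (j : Fin N) : secVar φ f a b j ≤ totalVar φ f := by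
  refine le_iSup_of_le a <| le_iSup_of_le b <| le_iSup_of_le ha <| le_iSup_of_le hab ?_
  refine le_iSup_of_le 1 <| le_iSup_of_le (fun _ => a) <| le_iSup_of_le (fun _ => b) <|
    le_iSup_of_le ⟨fun _ => hab, iUnion_const _, fun k l hkl => (hkl (Subsingleton.elim k l)).elim⟩
      ?_
  simpa using secVar_le_boxPhi φ f a b j

lemma intervalVar_eq_iSup (φ : ℝ → ℝ) (g : ℝ → ℝ) :
    intervalVar φ (fun _ _ => True) g =
      ⨆ k : ℕ, intervalVar φ (fun α β => -(k : ℝ) < α ∧ β < k) g := by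
  refine le_antisymm (intervalVar_le fun n α β h1 h2 => ?_)
    (iSup_le fun k => intervalVar_mono g fun _ _ _ _ => trivial)
  obtain ⟨k, hk⟩ := exists_nat_gt (∑ i, (|α i| + |β i|))
  have hb : ∀ i, |α i| + |β i| < k := fun i =>
    (Finset.single_le_sum (f := fun i => |α i| + |β i|) (fun _ _ => by positivity)
      (Finset.mem_univ i)).trans_lt hk
  refine le_iSup_of_le k (le_intervalVar φ g (fun i => ⟨(h1 i).1, ?_, ?_⟩) h2)
  · linarith [hb i, neg_abs_le (α i), abs_nonneg (β i)]
  · linarith [hb i, le_abs_self (β i), abs_nonneg (α i)]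

/-- If almost every section is continuous, the total variations of the sections are controlled by
the multidimensional variation. -/
lemma logSecVar_le_totalVar {φ : ℝ → ℝ} (hφ : IsPhiFun φ) {N : ℕ} {f : (Fin N → ℝ) → ℝ}
    (hf : Measurable f) (j : Fin N)
    (hc : ∀ᵐ y' : {i : Fin N // i ≠ j} → ℝ,
      Continuous fun s => f (expVec (insertCoord j y' s))) :
    logSecVar φ f j ≤ totalVar φ f := by
  set Γ : ({i : Fin N // i ≠ j} → ℝ) → ℝ → ℝ := fun y' s => f (expVec (insertCoord j y' s))
  have hΓ : ∀ s, Measurable fun y' => Γ y' s := fun s =>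
    hf.comp (measurable_expVec.comp ((measurable_insertCoord j).comp
      (measurable_id.prodMk measurable_const)))
  have hopen : ∀ k : ℕ, IsOpen {p : ℝ × ℝ | -(k : ℝ) < p.1 ∧ p.2 < k} := fun k =>
    (isOpen_lt continuous_const continuous_fst).inter (isOpen_lt continuous_snd continuous_const)
  set B : ℕ → Set ({i : Fin N // i ≠ j} → ℝ) := fun k => Set.pi univ fun _ => Icc (-(k : ℝ)) k
  have hB : ∀ k, MeasurableSet (B k) := fun k => MeasurableSet.univ_pi fun i => measurableSet_Icc
  have hBmono : Monotone B := fun k l hkl => Set.pi_mono fun i _ =>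
    Icc_subset_Icc (neg_le_neg (Nat.cast_le.2 hkl)) (Nat.cast_le.2 hkl)
  set V : ℕ → ({i : Fin N // i ≠ j} → ℝ) → ℝ≥0∞ := fun k y' =>
    intervalVar φ (fun α β => -(k : ℝ) < α ∧ β < k) (Γ y')
  have hVmono : ∀ y', Monotone fun k => V k y' := fun y' k l hkl =>
    intervalVar_mono _ fun α β _ h => by
      have : (k : ℝ) ≤ l := Nat.cast_le.2 hkl
      exact ⟨by linarith [h.1], by linarith [h.2]⟩
  have hpt : ∀ y', intervalVar φ (fun _ _ => True) (Γ y') = ⨆ k, (B k).indicator (V k) y' := by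
    intro y'
    refine le_antisymm ?_ (iSup_le fun k => (indicator_le_self _ _ _).trans
      (intervalVar_mono _ fun _ _ _ _ => trivial))
    rw [intervalVar_eq_iSup]
    refine iSup_le fun k => ?_
    obtain ⟨l, hl⟩ := exists_nat_ge ‖y'‖
    have hy : y' ∈ B (max k l) := fun i _ => by
      have h1 := (norm_le_pi_norm y' i).trans hl
      have h2 : (l : ℝ) ≤ (max k l : ℕ) := Nat.cast_le.2 (le_max_right _ _)
      exact abs_le.1 (h1.trans h2)
    refine le_iSup_of_le (max k l) ?_
    rw [indicator_of_mem hy]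
    exact hVmono y' (le_max_left _ _)
  have hle : logSecVar φ f j = ∫⁻ y', ⨆ k, (B k).indicator (V k) y' := lintegral_congr hpt
  rw [hle, lintegral_iSup' (fun k => (aemeasurable_intervalVar hφ (hopen k) hΓ hc).indicator (hB k))
    (Eventually.of_forall fun y' k l hkl => ?_)]
  · refine iSup_le fun k => ?_
    rw [lintegral_indicator (hB k)]
    have hk0 : (-(k : ℝ)) ≤ k := by linarith [k.cast_nonneg (α := ℝ)]
    refine le_trans ?_ (secVar_le_totalVar φ f (a := expVec fun _ => -(k : ℝ))
      (b := expVec fun _ => (k : ℝ)) (fun _ => Real.exp_pos _)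
      (fun _ => Real.exp_le_exp.2 hk0) j)
    rw [secVar_exp]
    refine lintegral_mono fun y' => ?_
    exact (intervalVar_mono _ fun α β _ h => ⟨h.1.le, h.2.le⟩).trans
      (intervalVar_le_phiVar1 φ hk0 _)
  · exact (indicator_le_indicator (hVmono y' hkl)).trans
      (indicator_le_indicator_of_subset (hBmono hkl) (fun _ => zero_le) y')

lemma ofReal_map_le_intervalVar (φ : ℝ → ℝ) (g : ℝ → ℝ) (p q : ℝ) :
    ENNReal.ofReal (φ |g q - g p|) ≤ intervalVar φ (fun _ _ => True) g := by
  wlog h : p ≤ q generalizing p q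
  · rw [abs_sub_comm]
    exact this q p (le_of_not_ge h)
  · simpa using le_intervalVar φ (C := fun _ _ => True) g (n := 1) (α := fun _ => p)
      (β := fun _ => q) (fun _ => ⟨h, trivial⟩) fun i k hik => (hik (Subsingleton.elim i k)).elim

lemma measurable_signType_cast : Measurable fun x : ℝ => ((SignType.sign x : SignType) : ℝ) := by
  have h : (fun x : ℝ => ((SignType.sign x : SignType) : ℝ)) =
      fun x => if 0 < x then 1 else if x < 0 then -1 else 0 := by
    funext x
    rw [sign_apply]
    split_ifs <;> simp
  rw [h]
  exact Measurable.ite measurableSet_Ioi measurable_const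
    (Measurable.ite measurableSet_Iio measurable_const measurable_const)

section Modulus

variable {φ : ℝ → ℝ} {ι : Type*} [Fintype ι] {Γ : (ι → ℝ) → ℝ → ℝ}

lemma IsPhiFun.measurable_ofReal_map_abs (hφ : IsPhiFun φ) {X : Type*} [MeasurableSpace X]
    {g : X → ℝ} (hg : Measurable g) : Measurable fun x => ENNReal.ofReal (φ |g x|) :=
  ENNReal.measurable_ofReal.comp (hφ.continuous_abs.measurable.comp hg)

lemma tendsto_lintegral_section_shift (hφ : IsPhiFun φ) (hΓ : ∀ s, Measurable fun y => Γ y s)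
    (hc : ∀ᵐ y, Continuous (Γ y)) (hfin : ∫⁻ y, intervalVar φ (fun _ _ => True) (Γ y) ≠ ⊤) (b : ℝ) :
    Tendsto (fun v => ∫⁻ y, ENNReal.ofReal (φ |1 / 2 * (Γ y (b + v) - Γ y b)|)) (nhds 0)
      (nhds 0) := by
  have h := tendsto_lintegral_filter_of_dominated_convergence (μ := volume) (l := nhds (0 : ℝ))
    (F := fun v y => ENNReal.ofReal (φ |1 / 2 * (Γ y (b + v) - Γ y b)|)) (f := fun _ => 0)
    (fun y => intervalVar φ (fun _ _ => True) (Γ y))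
    (Eventually.of_forall fun v =>
      hφ.measurable_ofReal_map_abs (((hΓ (b + v)).sub (hΓ b)).const_mul _))
    (Eventually.of_forall fun v => Eventually.of_forall fun y => ?_) hfin ?_
  · simpa using h
  · refine le_trans (ENNReal.ofReal_le_ofReal (hφ.map_abs_le ?_))
      (ofReal_map_le_intervalVar φ (Γ y) b (b + v))
    rw [abs_mul, abs_of_pos (by norm_num : (0 : ℝ) < 1 / 2)]
    linarith [abs_nonneg (Γ y (b + v) - Γ y b)]
  · filter_upwards [hc] with y hy
    have h1 : Continuous fun v => ENNReal.ofReal (φ |1 / 2 * (Γ y (b + v) - Γ y b)|) :=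
      ENNReal.continuous_ofReal.comp (hφ.continuous_abs.comp (by fun_prop))
    simpa [hφ.map_zero] using h1.tendsto 0

lemma tendsto_lintegral_increment_translate (hφ : IsPhiFun φ) (hΓ : ∀ s, Measurable fun y => Γ y s)
    (hfin : ∫⁻ y, intervalVar φ (fun _ _ => True) (Γ y) ≠ ⊤) (a b : ℝ) :
    Tendsto (fun u => ∫⁻ y, ENNReal.ofReal
      (φ |1 / 2 * ((Γ (y + u) b - Γ (y + u) a) - (Γ y b - Γ y a))|)) (nhds 0) (nhds 0) := by
  set S : (ι → ℝ) → ℝ := fun y =>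
    SignType.sign (Γ y b - Γ y a) * φ |Γ y b - Γ y a|
  have hD : Measurable fun y => Γ y b - Γ y a := (hΓ b).sub (hΓ a)
  have hSm : Measurable S :=
    (measurable_signType_cast.comp hD).mul
      (hφ.continuous_abs.measurable.comp hD)
  have hS : Integrable S volume := by
    refine ⟨hSm.aestronglyMeasurable, lt_of_le_of_lt (lintegral_mono fun y => ?_)
      (lt_top_iff_ne_top.2 hfin)⟩
    refine le_trans ?_ (ofReal_map_le_intervalVar φ (Γ y) a b)
    rw [Real.enorm_eq_ofReal_abs]
    refine ENNReal.ofReal_le_ofReal ?_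
    rw [abs_mul, abs_of_nonneg (hφ.nonneg (abs_nonneg _))]
    refine mul_le_of_le_one_left (hφ.nonneg (abs_nonneg _)) ?_
    rcases SignType.sign (Γ y b - Γ y a) with _ | _ | _ <;> simp
  refine tendsto_of_tendsto_of_tendsto_of_le_of_le tendsto_const_nhds
    (tendsto_lintegral_enorm_translate_sub hS) (fun _ => zero_le) fun u => ?_
  refine lintegral_mono fun y => ?_
  rw [Real.enorm_eq_ofReal_abs]
  refine ENNReal.ofReal_le_ofReal ?_
  have := hφ.map_abs_half_sub_le (Γ (y + u) b - Γ (y + u) a) (Γ y b - Γ y a)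
  rwa [div_eq_inv_mul, ← one_div] at this

/-- The `φ`-variation of the increments of the sections of `Γ` under the shift `z`. -/
def shiftVar (φ : ℝ → ℝ) (Γ : (ι → ℝ) → ℝ → ℝ) (z : (ι → ℝ) × ℝ) : ℝ≥0∞ :=
  ∫⁻ y, intervalVar φ (fun _ _ => True) fun s => 1 / 18 * (Γ (y + z.1) (s + z.2) - Γ y s)

lemma tendsto_lintegral_grid (hφ : IsPhiFun φ) (hΓ : ∀ s, Measurable fun y => Γ y s)
    (hc : ∀ᵐ y, Continuous (Γ y)) (hfin : ∫⁻ y, intervalVar φ (fun _ _ => True) (Γ y) ≠ ⊤)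
    (a b : ℝ) :
    Tendsto (fun z : (ι → ℝ) × ℝ => ∫⁻ y, ENNReal.ofReal
      (φ |3 * (1 / 18 * (Γ (y + z.1) (b + z.2) - Γ y b) -
        1 / 18 * (Γ (y + z.1) (a + z.2) - Γ y a))|)) (nhds 0) (nhds 0) := by
  have h1 := (tendsto_lintegral_section_shift hφ hΓ hc hfin b).comp
    (continuous_snd.tendsto (0 : (ι → ℝ) × ℝ))
  have h2 := (tendsto_lintegral_section_shift hφ hΓ hc hfin a).comp
    (continuous_snd.tendsto (0 : (ι → ℝ) × ℝ))
  have h3 := (tendsto_lintegral_increment_translate hφ hΓ hfin a b).comp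
    (continuous_fst.tendsto (0 : (ι → ℝ) × ℝ))
  have h := (h1.add h2).add h3
  rw [add_zero, add_zero] at h
  refine tendsto_of_tendsto_of_tendsto_of_le_of_le tendsto_const_nhds h (fun _ => zero_le) fun z => ?_
  have hm : ∀ b, Measurable fun y =>
      ENNReal.ofReal (φ |1 / 2 * (Γ (y + z.1) (b + z.2) - Γ (y + z.1) b)|) := fun b =>
    hφ.measurable_ofReal_map_abs ((((hΓ (b + z.2)).sub (hΓ b)).comp
      (measurable_add_const z.1)).const_mul _)
  have hsh : ∀ b, ∫⁻ y, ENNReal.ofReal (φ |1 / 2 * (Γ (y + z.1) (b + z.2) - Γ (y + z.1) b)|) =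
      ∫⁻ y, ENNReal.ofReal (φ |1 / 2 * (Γ y (b + z.2) - Γ y b)|) := fun b =>
    lintegral_add_right_eq_self
      (fun y => ENNReal.ofReal (φ |1 / 2 * (Γ y (b + z.2) - Γ y b)|)) z.1
  simp only [Function.comp_apply]
  rw [← hsh a, ← hsh b, ← lintegral_add_left (hm b), 
    ← lintegral_add_left (((hm b).add (hm a) : Measurable fun y => _ + _))]
  refine lintegral_mono fun y => ?_
  have := hφ.ofReal_map_add_three_le (1 / 6 * (Γ (y + z.1) (b + z.2) - Γ (y + z.1) b))
    (-(1 / 6 * (Γ (y + z.1) (a + z.2) - Γ (y + z.1) a)))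
    (1 / 6 * ((Γ (y + z.1) b - Γ (y + z.1) a) - (Γ y b - Γ y a)))
  simp only [mul_neg, abs_neg, ← mul_assoc] at this
  norm_num at this
  refine le_of_eq_of_le ?_ (this.trans_eq ?_)
  · congr 3; ring
  · norm_num

lemma tendsto_lintegral_shortOrFar (hφ : IsPhiFun φ) (hΓ : ∀ s, Measurable fun y => Γ y s)
    (hv : ∀ᵐ y, VanishingFineVar φ (Γ y))
    (hfin : ∫⁻ y, intervalVar φ (fun _ _ => True) (Γ y) ≠ ⊤) :
    Tendsto (fun m => ∫⁻ y, intervalVar φ (ShortOrFar m) (Γ y)) atTop (nhds 0) := by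
  have hc : ∀ᵐ y, Continuous (Γ y) := hv.mono fun y hy => hy.continuous hφ
  have hm : AEMeasurable (fun y => intervalVar φ (fun _ _ => True) (Γ y)) volume :=
    aemeasurable_intervalVar hφ (by simp) hΓ hc
  have h := tendsto_lintegral_of_dominated_convergence' (μ := volume)
    (F := fun m y => intervalVar φ (ShortOrFar m) (Γ y)) (f := fun _ => 0)
    (fun y => intervalVar φ (fun _ _ => True) (Γ y))
    (fun m => aemeasurable_intervalVar hφ (isOpen_shortOrFar m) hΓ hc)
    (fun m => Eventually.of_forall fun y => intervalVar_mono _ fun _ _ _ _ => trivial) hfin ?_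
  · simpa using h
  · filter_upwards [hv, ae_lt_top' hm hfin] with y hy hlt
    exact tendsto_intervalVar_shortOrFar φ hy hlt.ne

lemma shiftVar_le_two_mul (hφ : IsPhiFun φ) (hΓ : ∀ s, Measurable fun y => Γ y s)
    (hc : ∀ᵐ y, Continuous (Γ y)) (z : (ι → ℝ) × ℝ) :
    shiftVar φ Γ z ≤ 2 * ∫⁻ y, intervalVar φ (fun _ _ => True) (Γ y) := by
  have hm : AEMeasurable (fun y => intervalVar φ (fun _ _ => True) (Γ y)) volume :=
    aemeasurable_intervalVar hφ (by simp) hΓ hc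
  refine (lintegral_mono fun y => ?_ : shiftVar φ Γ z ≤
    ∫⁻ y, (intervalVar φ (fun _ _ => True) (Γ (y + z.1)) +
      intervalVar φ (fun _ _ => True) (Γ y))).trans_eq ?_
  · refine (intervalVar_sub_le hφ _ (Γ y) (fun s => Γ (y + z.1) (s + z.2))
      (by rw [abs_of_pos] <;> norm_num)).trans ?_
    gcongr
    exact intervalVar_mono_of_map (e := fun s => s + z.2) (add_left_mono)
      (fun _ _ _ _ => trivial) fun _ _ => le_rfl
  · rw [lintegral_add_right' _ hm,
      lintegral_add_right_eq_self (fun y => intervalVar φ (fun _ _ => True) (Γ y)), two_mul]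

/-- Continuity of shifts in variation: the variations of the increments tend to `0`. -/
lemma tendsto_shiftVar (hφ : IsPhiFun φ) (hΓ : ∀ s, Measurable fun y => Γ y s)
    (hv : ∀ᵐ y, VanishingFineVar φ (Γ y))
    (hfin : ∫⁻ y, intervalVar φ (fun _ _ => True) (Γ y) ≠ ⊤) :
    Tendsto (shiftVar φ Γ) (nhds 0) (nhds 0) := by
  have hc : ∀ᵐ y, Continuous (Γ y) := hv.mono fun y hy => hy.continuous hφ
  refine ENNReal.tendsto_nhds_zero.2 fun ε hε => ?_
  have hε2 : 0 < ε / 2 := ENNReal.half_pos hε.ne'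
  obtain ⟨m, hm⟩ : ∃ m, 6 * ∫⁻ y, intervalVar φ (ShortOrFar m) (Γ y) ≤ ε / 2 := by
    have := ENNReal.Tendsto.const_mul (tendsto_lintegral_shortOrFar hφ hΓ hv hfin)
      (Or.inr (by norm_num : (6 : ℝ≥0∞) ≠ ⊤))
    rw [mul_zero] at this
    exact (this.eventually_le_const hε2).exists
  obtain ⟨S, hS⟩ := exists_finset_grid (m + 1)
  have hgrid := tendsto_finsetSum (S ×ˢ S) fun x _ =>
    tendsto_lintegral_grid hφ hΓ hc hfin x.1 x.2
  rw [Finset.sum_const_zero] at hgrid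
  have hnear : ∀ᶠ z : (ι → ℝ) × ℝ in nhds 0, |z.2| ≤ 1 :=
    (continuous_snd.abs.tendsto (0 : (ι → ℝ) × ℝ)).eventually_le_const (by simp)
  filter_upwards [hgrid.eventually_le_const hε2, hnear] with z hz hz1
  have hE : AEMeasurable (fun y => intervalVar φ (ShortOrFar m) (Γ y)) volume :=
    aemeasurable_intervalVar hφ (isOpen_shortOrFar m) hΓ hc
  have hpt : ∀ y, intervalVar φ (fun _ _ => True)
      (fun s => 1 / 18 * (Γ (y + z.1) (s + z.2) - Γ y s)) ≤
      3 * (intervalVar φ (ShortOrFar m) (Γ (y + z.1)) + intervalVar φ (ShortOrFar m) (Γ y)) +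
      ∑ x ∈ S ×ˢ S, ENNReal.ofReal (φ |3 * (1 / 18 * (Γ (y + z.1) (x.2 + z.2) - Γ y x.2) -
        1 / 18 * (Γ (y + z.1) (x.1 + z.2) - Γ y x.1))|) := by
    intro y
    refine (intervalVar_le_shortOrFar_add_grid hφ hS _).trans ?_
    gcongr
    have e : (fun s => 3 * (1 / 18 * (Γ (y + z.1) (s + z.2) - Γ y s))) =
        fun s => 1 / 6 * (Γ (y + z.1) (s + z.2) - Γ y s) := by
      funext s; ring
    rw [e]
    refine (intervalVar_sub_le hφ _ (Γ y) (fun s => Γ (y + z.1) (s + z.2))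
      (by rw [abs_of_pos] <;> norm_num)).trans ?_
    gcongr
    · exact intervalVar_shortOrFar_shift_le φ _ m hz1
    · simpa using intervalVar_shortOrFar_shift_le φ (Γ y) m (s := 0) (by simp)
  refine (lintegral_mono hpt).trans ?_
  rw [lintegral_add_right _ (Finset.measurable_fun_sum _ fun x _ =>
      hφ.measurable_ofReal_map_abs ?_),
    lintegral_const_mul' _ _ (by norm_num), lintegral_add_right' _ hE,
    lintegral_add_right_eq_self (fun y => intervalVar φ (ShortOrFar m) (Γ y)),
    lintegral_finsetSum _ fun x _ => hφ.measurable_ofReal_map_abs ?_]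
  · rw [← ENNReal.add_halves ε]
    refine add_le_add (le_trans (le_of_eq ?_) hm) hz
    rw [← two_mul, ← mul_assoc]
    norm_num
  all_goals
    have h1 : ∀ s, Measurable fun y => 1 / 18 * (Γ (y + z.1) (s + z.2) - Γ y s) := fun s =>
      (((hΓ (s + z.2)).comp (measurable_add_const z.1)).sub (hΓ s)).const_mul _
    exact ((h1 x.2).sub (h1 x.1)).const_mul 3

end Modulus

/-- Jensen's inequality for a signed kernel of total mass one. -/
lemma IsPhiFun.ofReal_map_integral_le {φ : ℝ → ℝ} (hφ : IsPhiFun φ) {X : Type*} [MeasurableSpace X]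
    {ν : Measure X} {κ h : X → ℝ} {A : ℝ} (hκ : Measurable κ) (hh : Measurable h)
    (hκi : Integrable κ ν) (hone : ∫ x, κ x ∂ν = 1) (hA : ∫ x, |κ x| ∂ν ≤ A)
    (hint : Integrable (fun x => κ x * h x) ν) :
    ENNReal.ofReal (φ |∫ x, κ x * h x ∂ν|) ≤
      ∫⁻ x, ENNReal.ofReal (φ |A * h x|) ∂(ν.withDensity fun x => ENNReal.ofReal |κ x|) := by
  set ρ := ν.withDensity fun x => ENNReal.ofReal |κ x| with hρ
  have hdm : Measurable fun x => ENNReal.ofReal |κ x| := by fun_prop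
  have hdt : ∀ᵐ x ∂ν, ENNReal.ofReal |κ x| < ⊤ := Eventually.of_forall fun _ => ENNReal.ofReal_lt_top
  have : IsFiniteMeasure ρ := isFiniteMeasure_withDensity_ofReal hκi.abs.2
  set B := ∫ x, |κ x| ∂ν with hB
  have hB1 : 1 ≤ B := by
    rw [← hone]
    exact integral_mono hκi hκi.abs fun x => le_abs_self _
  have hB0 : 0 < B := one_pos.trans_le hB1
  have hρB : ρ.real univ = B := by
    have := integral_withDensity_eq_integral_toReal_smul (μ := ν) hdm hdt (fun _ => (1 : ℝ))
    simpa [ENNReal.toReal_ofReal (abs_nonneg _)] using this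
  have : NeZero ρ := ⟨fun h0 => by
    rw [h0] at hρB
    simp at hρB
    exact hB0.ne hρB⟩
  rcases eq_or_ne (∫⁻ x, ENNReal.ofReal (φ |A * h x|) ∂ρ) ⊤ with htop | htop
  · rw [htop]
    exact le_top
  have hm : ∀ c : ℝ, Measurable fun x => φ |c * h x| := fun c =>
    hφ.continuous_abs.measurable.comp (hh.const_mul c)
  have hiA : Integrable (fun x => φ |A * h x|) ρ := by
    refine ⟨(hm A).aestronglyMeasurable, ?_⟩
    refine lt_of_le_of_lt (lintegral_mono fun x => ?_) (lt_top_iff_ne_top.2 htop)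
    rw [Real.enorm_of_nonneg (hφ.nonneg (abs_nonneg _))]
  have hBA : ∀ x, φ |B * h x| ≤ φ |A * h x| := fun x => hφ.map_abs_le <| by
    rw [abs_mul, abs_mul, abs_of_pos hB0, abs_of_pos (hB0.trans_le hA)]
    gcongr
  have hiB : Integrable (fun x => φ |B * h x|) ρ :=
    hiA.mono' (hm B).aestronglyMeasurable (Eventually.of_forall fun x => by
      rw [Real.norm_of_nonneg (hφ.nonneg (abs_nonneg _))]
      exact hBA x)
  have hif : Integrable (fun x => |B * h x|) ρ := by
    rw [hρ, integrable_withDensity_iff_integrable_smul' hdm hdt]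
    refine (hint.abs.const_mul B).congr (Eventually.of_forall fun x => ?_)
    simp only [smul_eq_mul, ENNReal.toReal_ofReal (abs_nonneg _), abs_mul, abs_of_pos hB0]
    ring
  have hJ := hφ.1.map_average_le hφ.continuousOn isClosed_Ici
    (Eventually.of_forall fun x => mem_Ici.2 (abs_nonneg _)) hif hiB
  rw [average_eq, average_eq, hρB, smul_eq_mul, smul_eq_mul] at hJ
  have havg : B⁻¹ * ∫ x, |B * h x| ∂ρ = ∫ x, |κ x * h x| ∂ν := by
    rw [hρ, integral_withDensity_eq_integral_toReal_smul hdm hdt, ← integral_const_mul]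
    refine integral_congr_ae (Eventually.of_forall fun x => ?_)
    simp only [smul_eq_mul, ENNReal.toReal_ofReal (abs_nonneg _), abs_mul, abs_of_pos hB0]
    field_simp
  rw [← ofReal_integral_eq_lintegral_ofReal hiA
    (Eventually.of_forall fun x => hφ.nonneg (abs_nonneg _))]
  refine ENNReal.ofReal_le_ofReal ?_
  calc φ |∫ x, κ x * h x ∂ν| ≤ φ (∫ x, |κ x * h x| ∂ν) :=
        hφ.monotoneOn (mem_Ici.2 (abs_nonneg _))
          (mem_Ici.2 (integral_nonneg fun _ => abs_nonneg _)) (abs_integral_le_integral_abs)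
    _ ≤ B⁻¹ * ∫ x, φ |B * h x| ∂ρ := havg ▸ hJ
    _ ≤ ∫ x, φ |B * h x| ∂ρ :=
        mul_le_of_le_one_left (integral_nonneg fun _ => hφ.nonneg (abs_nonneg _))
          (inv_le_one_of_one_le₀ hB1)
    _ ≤ ∫ x, φ |A * h x| ∂ρ := integral_mono hiB hiA hBA

/-- A family of functions averaged against a signed kernel: the variation of the average is
controlled by the average of the variations. -/
lemma intervalVar_integral_le {φ : ℝ → ℝ} (hφ : IsPhiFun φ) {X : Type*} [MeasurableSpace X]
    {ν : Measure X} {κ : X → ℝ} {H : X → ℝ → ℝ} {A : ℝ} (hκ : Measurable κ)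
    (hH : ∀ s, Measurable fun x => H x s) (hκi : Integrable κ ν) (hone : ∫ x, κ x ∂ν = 1)
    (hA : ∫ x, |κ x| ∂ν ≤ A) (hint : ∀ s, Integrable (fun x => κ x * H x s) ν)
    (C : ℝ → ℝ → Prop) :
    intervalVar φ C (fun s => ∫ x, κ x * H x s ∂ν) ≤
      ∫⁻ x, intervalVar φ C (fun s => A * H x s)
        ∂(ν.withDensity fun x => ENNReal.ofReal |κ x|) := by
  refine intervalVar_le fun n α β h1 h2 => ?_
  have hstep : ∀ i, ENNReal.ofReal (φ |∫ x, κ x * H x (β i) ∂ν - ∫ x, κ x * H x (α i) ∂ν|) ≤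
      ∫⁻ x, ENNReal.ofReal (φ |A * H x (β i) - A * H x (α i)|)
        ∂(ν.withDensity fun x => ENNReal.ofReal |κ x|) := by
    intro i
    have hsub : Integrable (fun x => κ x * (H x (β i) - H x (α i))) ν := by
      simp only [mul_sub]
      exact (hint (β i)).sub (hint (α i))
    rw [← integral_sub (hint _) (hint _)]
    simp only [← mul_sub]
    exact hφ.ofReal_map_integral_le hκ ((hH _).sub (hH _)) hκi hone hA hsub
  refine (Finset.sum_le_sum fun i _ => hstep i).trans ((sum_lintegral_le _ _ _).trans ?_)
  exact lintegral_mono fun x => le_intervalVar φ (fun s => A * H x s) h1 h2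

lemma lintegral_lintegral_shift {φ : ℝ → ℝ} (hφ : IsPhiFun φ) {ι : Type*} [Fintype ι]
    {Γ : (ι → ℝ) → ℝ → ℝ} (hΓ : Measurable fun p : (ι → ℝ) × ℝ => Γ p.1 p.2)
    (hc : ∀ᵐ y, Continuous (Γ y)) {X : Type*} [MeasurableSpace X] (ρ : Measure X) [SFinite ρ]
    {z : X → (ι → ℝ) × ℝ} (hz : Measurable z) :
    ∫⁻ y, ∫⁻ t, intervalVar φ (fun _ _ => True)
      (fun s => 1 / 18 * (Γ (y + (z t).1) (s + (z t).2) - Γ y s)) ∂ρ =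
      ∫⁻ t, shiftVar φ Γ (z t) ∂ρ := by
  have hq : Measure.QuasiMeasurePreserving (fun p : (ι → ℝ) × X => p.1 + (z p.2).1)
      (volume.prod ρ) volume :=
    QuasiMeasurePreserving.prod_of_left
      (measurable_fst.add (measurable_fst.comp (hz.comp measurable_snd)))
      (Eventually.of_forall fun t => (measurePreserving_add_right volume (z t).1).quasiMeasurePreserving)
  have h1 : Measurable fun p : (ι → ℝ) × X => p.1 + (z p.2).1 :=
    measurable_fst.add (measurable_fst.comp (hz.comp measurable_snd))
  have h2 : Measurable fun p : (ι → ℝ) × X => (z p.2).2 :=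
    measurable_snd.comp (hz.comp measurable_snd)
  have hm : ∀ s, Measurable fun p : (ι → ℝ) × X =>
      1 / 18 * (Γ (p.1 + (z p.2).1) (s + (z p.2).2) - Γ p.1 s) := fun s =>
    ((hΓ.comp (h1.prodMk (h2.const_add s))).sub
      (hΓ.comp (measurable_fst.prodMk measurable_const))).const_mul _
  have hcont : ∀ᵐ p ∂((volume : Measure (ι → ℝ)).prod ρ), Continuous fun s =>
      1 / 18 * (Γ (p.1 + (z p.2).1) (s + (z p.2).2) - Γ p.1 s) := by
    filter_upwards [hq.ae hc, Measure.quasiMeasurePreserving_fst.ae hc] with p h3 h4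
    have h5 : Continuous fun s => Γ (p.1 + (z p.2).1) (s + (z p.2).2) :=
      h3.comp (continuous_add_const _)
    exact (h5.sub h4).const_mul _
  have hae := aemeasurable_intervalVar hφ (C := fun _ _ => True) (by simp) hm hcont
  exact lintegral_lintegral_swap (f := fun y t => intervalVar φ (fun _ _ => True)
    (fun s => 1 / 18 * (Γ (y + (z t).1) (s + (z t).2) - Γ y s))) hae

lemma measurableSet_RPos {N : ℕ} : MeasurableSet (RPos N) := by
  have : RPos N = Set.pi univ fun _ => Ioi 0 := by
    ext; simp [RPos]
  rw [this]
  exact MeasurableSet.univ_pi fun i => measurableSet_Ioi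

lemma measurable_prodCoord_inv {N : ℕ} : Measurable fun t : Fin N → ℝ => (prodCoord t)⁻¹ :=
  (Finset.measurable_fun_prod _ fun i _ => measurable_pi_apply i).inv

lemma measurable_distOne {N : ℕ} : Measurable (distOne : (Fin N → ℝ) → ℝ) := by
  unfold distOne
  fun_prop

lemma dist_one_le_distOne {N : ℕ} (t : Fin N → ℝ) : dist t 1 ≤ distOne t := by
  refine (dist_pi_le_iff (Real.sqrt_nonneg _)).2 fun i => ?_
  refine Real.le_sqrt_of_sq_le ?_
  rw [dist_comm, Real.dist_eq, sq_abs]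
  exact Finset.single_le_sum (f := fun i => (1 - t i) ^ 2) (fun i _ => sq_nonneg _)
    (Finset.mem_univ i)

/-- The measure `|K(t)| ⟨t⟩⁻¹ dt` on the positive orthant. -/
def kernelMeasure {N : ℕ} (K : (Fin N → ℝ) → ℝ) : Measure (Fin N → ℝ) :=
  (volume.restrict (RPos N)).withDensity fun t => ENNReal.ofReal |K t * (prodCoord t)⁻¹|

lemma abs_kernel_eq {N : ℕ} (K : (Fin N → ℝ) → ℝ) {t : Fin N → ℝ} (ht : t ∈ RPos N) :
    |K t * (prodCoord t)⁻¹| = |K t| * (prodCoord t)⁻¹ := by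
  have h : 0 < prodCoord t := Finset.prod_pos fun i _ => ht i
  rw [abs_mul, abs_of_pos (inv_pos.2 h)]

/-- The logarithm of `t`, with its `j`-th coordinate split off. -/
def logSplit {N : ℕ} (j : Fin N) (t : Fin N → ℝ) : ({i : Fin N // i ≠ j} → ℝ) × ℝ :=
  (fun i => Real.log (t i), Real.log (t j))

lemma measurable_logSplit {N : ℕ} (j : Fin N) : Measurable (logSplit j) :=
  (measurable_pi_lambda _ fun i => Real.measurable_log.comp (measurable_pi_apply i.1)).prodMk
    (Real.measurable_log.comp (measurable_pi_apply j))

lemma tendsto_logSplit {N : ℕ} (j : Fin N) : Tendsto (logSplit j) (nhds 1) (nhds 0) := by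
  have h : ∀ i : Fin N, Tendsto (fun t : Fin N → ℝ => Real.log (t i)) (nhds 1) (nhds 0) := fun i => by
    have := (Real.continuousAt_log one_ne_zero).tendsto.comp
      ((continuous_apply i).tendsto (1 : Fin N → ℝ))
    simpa [Function.comp_def] using this
  exact (tendsto_pi_nhds.2 fun i : {i : Fin N // i ≠ j} => h i).prodMk_nhds (h j)

lemma expVec_insertCoord_mul {N : ℕ} (j : Fin N) (y' : {i : Fin N // i ≠ j} → ℝ) (s : ℝ)
    {t : Fin N → ℝ} (ht : t ∈ RPos N) :
    expVec (insertCoord j y' s) * t =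
      expVec (insertCoord j (y' + (logSplit j t).1) (s + (logSplit j t).2)) := by
  funext i
  by_cases h : i = j
  · subst h
    simp [expVec, insertCoord, logSplit, Real.exp_add, Real.exp_log (ht i)]
  · simp [expVec, insertCoord, logSplit, h, Real.exp_add, Real.exp_log (ht i)]

lemma expVec_mem_RPos {N : ℕ} (y : Fin N → ℝ) : expVec y ∈ RPos N := fun _ => Real.exp_pos _

section Mellin

variable {φ : ℝ → ℝ} {N : ℕ} {K : ℝ → (Fin N → ℝ) → ℝ} {A : ℝ} {f : (Fin N → ℝ) → ℝ}

lemma KernelCond1.integral_abs_le (hK : KernelCond1 K A) {w : ℝ} (hw : 0 < w) :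
    ∫ t in RPos N, |K w t * (prodCoord t)⁻¹| ≤ A := by
  refine le_trans (le_of_eq ?_) (hK w hw).2.2.1
  exact setIntegral_congr_fun measurableSet_RPos fun t ht => abs_kernel_eq _ ht

lemma KernelCond1.kernelMeasure_univ_le (hK : KernelCond1 K A) {w : ℝ} (hw : 0 < w) :
    kernelMeasure (K w) univ ≤ ENNReal.ofReal A := by
  rw [kernelMeasure, withDensity_apply _ MeasurableSet.univ, Measure.restrict_univ,
    ← ofReal_integral_eq_lintegral_ofReal (hK w hw).2.1.abs
      (Eventually.of_forall fun _ => abs_nonneg _)]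
  exact ENNReal.ofReal_le_ofReal (hK.integral_abs_le hw)

lemma KernelCond1.tendsto_kernelMeasure (hK : KernelCond1 K A) (hK2 : KernelCond2 K) {δ : ℝ}
    (hδ : 0 < δ) (hδ1 : δ < 1) :
    Tendsto (fun w => kernelMeasure (K w) {t | δ < distOne t}) atTop (nhds 0) := by
  have h := ENNReal.tendsto_ofReal (hK2 δ hδ hδ1)
  rw [ENNReal.ofReal_zero] at h
  refine h.congr' ?_
  filter_upwards [eventually_gt_atTop 0] with w hw
  have hms : MeasurableSet {t : Fin N → ℝ | δ < distOne t} :=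
    measurableSet_lt measurable_const measurable_distOne
  have e : {t ∈ RPos N | δ < distOne t} = {t | δ < distOne t} ∩ RPos N := by
    ext t; exact and_comm
  rw [kernelMeasure, withDensity_apply _ hms, Measure.restrict_restrict hms, ← e,
    ← ofReal_integral_eq_lintegral_ofReal
      (((hK w hw).2.1.mono_set (fun t ht => ht.1)).abs)
      (Eventually.of_forall fun _ => abs_nonneg _)]
  congr 1
  exact setIntegral_congr_fun (e ▸ hms.inter measurableSet_RPos) fun t ht =>
    (abs_kernel_eq _ ht.1).symm

/-- Averages of a bounded function which is small near `1` against the kernel measures vanish in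
the limit. -/
lemma KernelCond1.tendsto_lintegral (hK : KernelCond1 K A) (hK2 : KernelCond2 K)
    {M : (Fin N → ℝ) → ℝ≥0∞} (hM : Tendsto M (nhds 1) (nhds 0)) {B : ℝ≥0∞} (hB : B ≠ ⊤)
    (hMB : ∀ t, M t ≤ B) :
    Tendsto (fun w => ∫⁻ t, M t ∂(kernelMeasure (K w))) atTop (nhds 0) := by
  refine ENNReal.tendsto_nhds_zero.2 fun ε hε => ?_
  have hε2 : 0 < ε / 2 := ENNReal.half_pos hε.ne'
  set η : ℝ≥0∞ := ε / 2 / (ENNReal.ofReal A + 1)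
  have hη : 0 < η := ENNReal.div_pos hε2.ne' (by simp)
  obtain ⟨r, hr, hball⟩ := Metric.eventually_nhds_iff.1 (hM.eventually_le_const hη)
  set δ : ℝ := min (r / 2) (1 / 2)
  have hδ : 0 < δ := lt_min (by linarith) (by norm_num)
  have hδ1 : δ < 1 := (min_le_right _ _).trans_lt (by norm_num)
  have hδr : δ < r := (min_le_left _ _).trans_lt (by linarith)
  have hms : MeasurableSet {t : Fin N → ℝ | δ < distOne t} :=
    measurableSet_lt measurable_const measurable_distOne
  have htail := ENNReal.Tendsto.const_mul (hK.tendsto_kernelMeasure hK2 hδ hδ1) (Or.inr hB)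
  rw [mul_zero] at htail
  filter_upwards [htail.eventually_le_const hε2, eventually_gt_atTop 0] with w hw hw0
  have hpt : ∀ t, M t ≤ η + {t | δ < distOne t}.indicator (fun _ => B) t := by
    intro t
    by_cases ht : δ < distOne t
    · rw [indicator_of_mem (by exact ht)]
      exact (hMB t).trans le_add_self
    · refine le_trans (hball ?_) le_self_add
      exact (dist_one_le_distOne t).trans_lt ((not_lt.1 ht).trans_lt hδr)
  refine (lintegral_mono hpt).trans ?_
  rw [lintegral_add_left measurable_const, lintegral_const, lintegral_indicator hms,
    setLIntegral_const, ← ENNReal.add_halves ε]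
  refine add_le_add ?_ hw
  calc η * kernelMeasure (K w) univ ≤ η * (ENNReal.ofReal A + 1) := by
        gcongr
        exact (hK.kernelMeasure_univ_le hw0).trans le_self_add
    _ ≤ ε / 2 := mul_comm η _ ▸ ENNReal.mul_div_le

lemma mellinOp_sub_eq {w : ℝ} (hw : 0 < w) (hK : KernelCond1 K A) (hdom : InDomain K f) (c : ℝ)
    {s : Fin N → ℝ} (hs : s ∈ RPos N) :
    IntegrableOn (fun t => K w t * (prodCoord t)⁻¹ * (c * (f (s * t) - f s))) (RPos N) ∧
    c * (mellinOp (K w) f s - f s) =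
      ∫ t in RPos N, K w t * (prodCoord t)⁻¹ * (c * (f (s * t) - f s)) := by
  have e : (fun t => K w t * (prodCoord t)⁻¹ * (c * (f (s * t) - f s))) = fun t =>
      c * (K w t * f (s * t) * (prodCoord t)⁻¹ - K w t * (prodCoord t)⁻¹ * f s) := by
    funext t; ring
  have h1 := hdom w hw s hs
  have h2 := (hK w hw).2.1.mul_const (f s)
  rw [e]
  refine ⟨(h1.sub h2).const_mul c, ?_⟩
  rw [integral_const_mul, integral_sub h1 h2, integral_mul_const, (hK w hw).2.2.2, one_mul,
    mellinOp]

/-- The section variations of `T f - f` are dominated by an average of shift variations of `f`. -/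
lemma logSecVar_mellinOp_sub_le (hφ : IsPhiFun φ) (hA : 0 < A) (hK : KernelCond1 K A)
    (hdom : InDomain K f) (hf : Measurable f) {l : ℝ} (j : Fin N)
    (hc : ∀ᵐ y' : {i : Fin N // i ≠ j} → ℝ,
      Continuous fun s => l * f (expVec (insertCoord j y' s))) {w : ℝ} (hw : 0 < w) :
    logSecVar φ (fun s => l / (18 * A) * (mellinOp (K w) f s - f s)) j ≤
      ∫⁻ t, shiftVar φ (fun y' s => l * f (expVec (insertCoord j y' s))) (logSplit j t)
        ∂(kernelMeasure (K w)) := by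
  have hκ : Measurable fun t => K w t * (prodCoord t)⁻¹ :=
    (hK w hw).1.mul measurable_prodCoord_inv
  have hfin : IsFiniteMeasure (kernelMeasure (K w)) :=
    ⟨(hK.kernelMeasure_univ_le hw).trans_lt ENNReal.ofReal_lt_top⟩
  rw [← lintegral_lintegral_shift hφ (Γ := fun y' s => l * f (expVec (insertCoord j y' s)))
    ((hf.comp (measurable_expVec.comp (measurable_insertCoord j))).const_mul l) hc _
    (measurable_logSplit j)]
  refine lintegral_mono fun y' => ?_
  have hrep := fun s : ℝ => mellinOp_sub_eq hw hK hdom (l / (18 * A))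
    (expVec_mem_RPos (insertCoord j y' s))
  simp only [fun s => (hrep s).2]
  refine (intervalVar_integral_le hφ hκ
    (H := fun t s => l / (18 * A) * (f (expVec (insertCoord j y' s) * t) -
      f (expVec (insertCoord j y' s))))
    (fun s => ((hf.comp (measurable_const_mul _)).sub measurable_const).const_mul _)
    (hK w hw).2.1 (hK w hw).2.2.2 (hK.integral_abs_le hw) (fun s => (hrep s).1) _).trans ?_
  refine lintegral_mono_ae ?_
  have hpos : ∀ᵐ t ∂(kernelMeasure (K w)), t ∈ RPos N :=
    (withDensity_absolutelyContinuous _ _).ae_le (ae_restrict_mem measurableSet_RPos)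
  filter_upwards [hpos] with t ht
  refine le_of_eq ?_
  congr 1
  funext s
  rw [expVec_insertCoord_mul j y' s ht]
  field_simp

end Mellin

/-- main convergence theorem: for `f ∈ AC^φ(ℝ^N_+)` in the domain of the
operators and kernels satisfying `(K_w.1)` and `(K_w.2)`, there exists `μ > 0` with
`V^φ[μ(T_w f − f)] → 0` as `w → +∞`. -/
theorem statement4 {N : ℕ} (hN : 1 ≤ N) (φ : ℝ → ℝ) (hφ : IsPhiFun φ)
    (K : ℝ → (Fin N → ℝ) → ℝ) (A : ℝ) (hA : 0 < A)
    (hK1 : KernelCond1 K A) (hK2 : KernelCond2 K)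
    (f : (Fin N → ℝ) → ℝ) (hf : MemACphi φ f) (hdom : InDomain K f) :
    ∃ μ > (0 : ℝ),
      Tendsto (fun w => totalVar φ (fun s => μ * (mellinOp (K w) f s - f s)))
        atTop (nhds 0) := by
  obtain ⟨⟨hfm, l₁, hl₁, hbv⟩, l₂, hl₂, hac⟩ := hf
  set l := min l₁ l₂
  have hl : 0 < l := lt_min hl₁ hl₂
  have hv := fun j => (hac.mono hφ hl.le (min_le_right _ _)).ae_vanishingFineVar hφ hl j
  have hc : ∀ j, ∀ᵐ y' : {i : Fin N // i ≠ j} → ℝ,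
      Continuous fun s => l * f (expVec (insertCoord j y' s)) :=
    fun j => (hv j).mono fun y' hy => hy.continuous hφ
  have hfin : ∀ j, ∫⁻ y', intervalVar φ (fun _ _ => True)
      (fun s => l * f (expVec (insertCoord j y' s))) ≠ ⊤ := by
    intro j
    have hc₁ : ∀ᵐ y' : {i : Fin N // i ≠ j} → ℝ,
        Continuous fun s => l₁ * f (expVec (insertCoord j y' s)) := (hc j).mono fun y' hy => by
      refine (hy.const_mul (l₁ / l)).congr fun s => ?_
      field_simp
    refine ne_top_of_le_ne_top hbv.ne (le_trans (lintegral_mono fun y' => ?_)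
      (logSecVar_le_totalVar hφ (hfm.const_mul l₁) j hc₁))
    refine intervalVar_mono_of_map monotone_id (fun _ _ _ h => h) fun α β => hφ.map_abs_le ?_
    rw [id, id, ← mul_sub, ← mul_sub, abs_mul, abs_mul, abs_of_pos hl, abs_of_pos hl₁]
    exact mul_le_mul_of_nonneg_right (min_le_left _ _) (abs_nonneg _)
  have hΓ : ∀ j s, Measurable fun y' => l * f (expVec (insertCoord j y' s)) := fun j s =>
    (hfm.comp (measurable_expVec.comp ((measurable_insertCoord j).comp
      (measurable_id.prodMk measurable_const)))).const_mul l
  refine ⟨l / (18 * A), by positivity, ?_⟩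
  have hlim := tendsto_finsetSum Finset.univ fun j _ =>
    hK1.tendsto_lintegral hK2
      ((tendsto_shiftVar hφ (hΓ j) (hv j) (hfin j)).comp (tendsto_logSplit j))
      (ENNReal.mul_ne_top (by norm_num : (2 : ℝ≥0∞) ≠ ⊤) (hfin j))
      fun t => shiftVar_le_two_mul hφ (hΓ j) (hc j) (logSplit j t)
  rw [Finset.sum_const_zero] at hlim
  refine tendsto_of_tendsto_of_tendsto_of_le_of_le' tendsto_const_nhds hlim
    (Eventually.of_forall fun _ => zero_le) ?_
  filter_upwards [eventually_gt_atTop 0] with w hw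
  exact (totalVar_le_sum_logSecVar hφ _).trans (Finset.sum_le_sum fun j _ =>
    logSecVar_mellinOp_sub_le hφ hA hK1 hdom hfm j (hc j) hw)

end
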